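/- arXiv:1803.10538 — 2 statements merged into one kernel-verified Lean document; each statement's English description precedes it below -/
import Mathlib

section
/- Let G := {(x,y) ∈ ℝ² : −1 < x < 1, y ≥ x²/(1−x²)} and L := 2π. Then the problem of maximizing area among subsets of cl(G) of perimeter L has no solution: the supremum sup{ L²(E) : E ⊆ cl(G) measurable, Per(E) = 2π } equals π, but for every measurable E ⊆ cl(G) with Per(E) = 2π one has L²(E) < π. -/
open MeasureTheory
open scoped ENNReal

/-- The divergence of a vector field on `ℝⁿ`. -/
noncomputable def vecDiv {n : ℕ} (φ : EuclideanSpace ℝ (Fin n) → EuclideanSpace ℝ (Fin n))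
    (x : EuclideanSpace ℝ (Fin n)) : ℝ :=
  ∑ i : Fin n, fderiv ℝ φ x (EuclideanSpace.single i 1) i

/-- The perimeter of a set `E` relative to an open set `F`:
`Per(E;F) = sup { ∫_E div φ dx : φ ∈ C¹_0(F, ℝⁿ), |φ| ≤ 1 }`. -/
noncomputable def perIn {n : ℕ} (E F : Set (EuclideanSpace ℝ (Fin n))) : ℝ≥0∞ :=
  ⨆ φ : {φ : EuclideanSpace ℝ (Fin n) → EuclideanSpace ℝ (Fin n) //
      ContDiff ℝ 1 φ ∧ HasCompactSupport φ ∧ tsupport φ ⊆ F ∧ ∀ x, ‖φ x‖ ≤ 1},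
    ENNReal.ofReal (∫ x in E, vecDiv φ.1 x)

/-- The perimeter of `E` (relative to all of `ℝⁿ`). -/
noncomputable def per {n : ℕ} (E : Set (EuclideanSpace ℝ (Fin n))) : ℝ≥0∞ :=
  perIn E Set.univ

section

open Set Filter Topology

/-- Every `C¹` test field with compact support and length at most one has flux at most `P`
through the boundary of the planar set `S`. -/
def PlanarPerimeterLE (S : Set (ℝ × ℝ)) (P : ℝ) : Prop :=
  ∀ u v : ℝ × ℝ → ℝ, ContDiff ℝ 1 u → ContDiff ℝ 1 v → HasCompactSupport u →
    HasCompactSupport v → (∀ p, u p ^ 2 + v p ^ 2 ≤ 1) →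
    ∫ p in S, (fderiv ℝ u p (1, 0) + fderiv ℝ v p (0, 1)) ≤ P

lemma fderiv_apply_one_zero_eq {u : ℝ × ℝ → ℝ} {p : ℝ × ℝ} (hu : DifferentiableAt ℝ u p) {d : ℝ}
    (h : HasDerivAt (fun t => u (t, p.2)) d p.1) : fderiv ℝ u p (1, 0) = d := by
  have h1 : HasDerivAt (fun t : ℝ => (t, p.2)) (1, 0) p.1 :=
    (hasDerivAt_id p.1).prodMk (hasDerivAt_const p.1 p.2)
  exact (HasFDerivAt.comp_hasDerivAt (f := fun t : ℝ => (t, p.2)) p.1 hu.hasFDerivAt h1).unique h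

lemma fderiv_apply_zero_one_eq {u : ℝ × ℝ → ℝ} {p : ℝ × ℝ} (hu : DifferentiableAt ℝ u p) {d : ℝ}
    (h : HasDerivAt (fun t => u (p.1, t)) d p.2) : fderiv ℝ u p (0, 1) = d := by
  have h1 : HasDerivAt (fun t : ℝ => (p.1, t)) (0, 1) p.2 :=
    (hasDerivAt_const p.2 p.1).prodMk (hasDerivAt_id p.2)
  exact (HasFDerivAt.comp_hasDerivAt (f := fun t : ℝ => (p.1, t)) p.2 hu.hasFDerivAt h1).unique h

lemma hasDerivAt_snd_slice {u : ℝ × ℝ → ℝ} {p : ℝ × ℝ} (hu : DifferentiableAt ℝ u p) :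
    HasDerivAt (fun t => u (p.1, t)) (fderiv ℝ u p (0, 1)) p.2 := by
  have h1 : HasDerivAt (fun t : ℝ => (p.1, t)) (0, 1) p.2 :=
    (hasDerivAt_const p.2 p.1).prodMk (hasDerivAt_id p.2)
  exact HasFDerivAt.comp_hasDerivAt (f := fun t : ℝ => (p.1, t)) p.2 hu.hasFDerivAt h1

/-- A smooth cutoff function on the line. -/
lemma exists_cutoff : ∃ χ : ℝ → ℝ, ContDiff ℝ 1 χ ∧ HasCompactSupport χ ∧
    (∀ t, 0 ≤ χ t ∧ χ t ≤ 1) ∧ (∀ t, |t| ≤ 1 → χ t = 1) ∧ ∃ C, ∀ t, |deriv χ t| ≤ C := by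
  let b : ContDiffBump (0 : ℝ) := ⟨1, 2, one_pos, one_lt_two⟩
  have hb : ContDiff ℝ 1 b := b.contDiff
  refine ⟨b, hb, b.hasCompactSupport, fun t => ⟨b.nonneg, b.le_one⟩, fun t ht => ?_, ?_⟩
  · apply b.one_of_mem_closedBall
    simpa [b] using ht
  · obtain ⟨C, hC⟩ := b.hasCompactSupport.deriv.exists_bound_of_continuous
      (hb.continuous_deriv le_rfl)
    exact ⟨C, fun t => by simpa using hC t⟩

/-- Dilated cutoffs. -/
lemma exists_cutoff_seq : ∃ (χ : ℕ → ℝ → ℝ) (C : ℝ), (∀ n, ContDiff ℝ 1 (χ n)) ∧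
    (∀ n, HasCompactSupport (χ n)) ∧ (∀ n t, 0 ≤ χ n t ∧ χ n t ≤ 1) ∧
    (∀ t, Tendsto (fun n => χ n t) atTop (𝓝 1)) ∧ (∀ n t, |deriv (χ n) t| ≤ C) ∧
    (∀ t, Tendsto (fun n => deriv (χ n) t) atTop (𝓝 0)) := by
  obtain ⟨χ, h1, h2, h3, h4, C, hC⟩ := exists_cutoff
  have hd : ∀ (n : ℕ) (t : ℝ), deriv (fun t => χ (((n : ℝ) + 1)⁻¹ * t)) t
      = ((n : ℝ) + 1)⁻¹ * deriv χ (((n : ℝ) + 1)⁻¹ * t) := by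
    intro n t
    have := ((h1.differentiable one_ne_zero) (((n : ℝ) + 1)⁻¹ * t)).hasDerivAt.comp t
      ((hasDerivAt_id t).const_mul (((n : ℝ) + 1)⁻¹))
    rw [mul_comm]
    simpa [Function.comp_def] using this.deriv
  have h0 : Tendsto (fun n : ℕ => ((n : ℝ) + 1)⁻¹) atTop (𝓝 0) := by
    simpa using tendsto_one_div_add_atTop_nhds_zero_nat (𝕜 := ℝ)
  have hC0 : 0 ≤ C := (abs_nonneg _).trans (hC 0)
  have hb : ∀ (n : ℕ) (t : ℝ), |deriv (fun t => χ (((n : ℝ) + 1)⁻¹ * t)) t| ≤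
      ((n : ℝ) + 1)⁻¹ * C := by
    intro n t
    have : (0 : ℝ) ≤ ((n : ℝ) + 1)⁻¹ := by positivity
    rw [hd, abs_mul, abs_of_nonneg this]
    exact mul_le_mul_of_nonneg_left (hC _) this
  refine ⟨fun n t => χ (((n : ℝ) + 1)⁻¹ * t), C, fun n => by fun_prop, fun n => ?_,
    fun n t => h3 _, fun t => ?_, fun n t => ?_, fun t => ?_⟩
  · have hn : ((n : ℝ) + 1)⁻¹ ≠ 0 := by positivity
    exact h2.comp_homeomorph (Homeomorph.mulLeft₀ _ hn)
  · apply tendsto_const_nhds.congr'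
    have : Tendsto (fun n : ℕ => |((n : ℝ) + 1)⁻¹ * t|) atTop (𝓝 0) := by
      simpa using (h0.mul_const t).abs
    filter_upwards [this.eventually (Iic_mem_nhds one_pos)] with n hn
    exact (h4 _ hn).symm
  · refine (hb n t).trans (mul_le_of_le_one_left hC0 ?_)
    exact inv_le_one_of_one_le₀ (by linarith [n.cast_nonneg (α := ℝ)])
  · refine squeeze_zero_norm (fun n => hb n t) ?_
    simpa using h0.mul_const C

/-- Testing the perimeter with `(X(x), W(x) s(x, y))`. -/
lemma PlanarPerimeterLE.integral_le {S : Set (ℝ × ℝ)} {P : ℝ}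
    (hP : PlanarPerimeterLE S P) (hfin : ∀ R : ℝ, volume (S ∩ Icc (-R) R ×ˢ univ) < ⊤)
    {X W : ℝ → ℝ} (hX : ContDiff ℝ 1 X) (hW : ContDiff ℝ 1 W) (hXc : HasCompactSupport X)
    (hWc : HasCompactSupport W) (hXW : ∀ x, X x ^ 2 + W x ^ 2 ≤ 1)
    {s k : ℝ × ℝ → ℝ} (hs : ContDiff ℝ 1 s) (hs1 : ∀ p, |s p| ≤ 1) (hk : Continuous k)
    (hsk : ∀ p, fderiv ℝ s p (0, 1) = k p) {C : ℝ} (hkC : ∀ p, |k p| ≤ C) :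
    ∫ p in S, (deriv X p.1 + W p.1 * k p) ≤ P := by
  obtain ⟨χ, C', hχ, hχc, hχ1, hχl, hχC, hχd⟩ := exists_cutoff_seq
  obtain ⟨R, hR⟩ : ∃ R : ℝ, ∀ x, x ∉ Icc (-R) R → X x = 0 ∧ W x = 0 ∧ deriv X x = 0 := by
    obtain ⟨R1, h1⟩ := hXc.isCompact.isBounded.subset_closedBall 0
    obtain ⟨R2, h2⟩ := hWc.isCompact.isBounded.subset_closedBall 0
    refine ⟨max R1 R2, fun x hx => ?_⟩
    have hx' : max R1 R2 < |x| := by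
      by_contra! h
      exact hx (abs_le.1 h)
    have e1 : x ∉ tsupport X := fun h => by
      have := h1 h
      simp at this
      exact absurd hx' (not_lt.2 (this.trans (le_max_left _ _)))
    have e2 : x ∉ tsupport W := fun h => by
      have := h2 h
      simp at this
      exact absurd hx' (not_lt.2 (this.trans (le_max_right _ _)))
    exact ⟨image_eq_zero_of_notMem_tsupport e1, image_eq_zero_of_notMem_tsupport e2,
      image_eq_zero_of_notMem_tsupport fun h => e1 (tsupport_deriv_subset h)⟩
  obtain ⟨M, hM⟩ := hXc.deriv.exists_bound_of_continuous (hX.continuous_deriv le_rfl)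
  have hW1 : ∀ x, |W x| ≤ 1 := fun x => by
    rw [← sq_le_one_iff_abs_le_one]
    nlinarith [hXW x, sq_nonneg (X x)]
  have hM0 : 0 ≤ M := (norm_nonneg _).trans (hM 0)
  have hC0 : 0 ≤ C := (abs_nonneg _).trans (hkC 0)
  have hC'0 : 0 ≤ C' := (abs_nonneg _).trans (hχC 0 0)
  let F : ℕ → ℝ × ℝ → ℝ := fun n p =>
    deriv X p.1 * χ n p.2 + (W p.1 * k p * χ n p.2 + W p.1 * s p * deriv (χ n) p.2)
  have hF : ∀ n, ∫ p in S, F n p ≤ P := by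
    intro n
    have hu : ContDiff ℝ 1 fun p : ℝ × ℝ => X p.1 * χ n p.2 := by
      have := hχ n
      fun_prop
    have hv : ContDiff ℝ 1 fun p : ℝ × ℝ => W p.1 * s p * χ n p.2 := by
      have := hχ n
      fun_prop
    have key := hP (fun p => X p.1 * χ n p.2) (fun p => W p.1 * s p * χ n p.2) hu hv ?_ ?_ ?_
    · convert key using 3 with p
      refine congr_arg₂ (· + ·) ?_ ?_
      · refine (fderiv_apply_one_zero_eq (hu.differentiable one_ne_zero p) ?_).symm
        exact ((hX.differentiable one_ne_zero) p.1).hasDerivAt.mul_const (χ n p.2)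
      · refine (fderiv_apply_zero_one_eq (hv.differentiable one_ne_zero p) ?_).symm
        have h1 := hasDerivAt_snd_slice (hs.differentiable one_ne_zero p)
        rw [hsk] at h1
        exact (h1.const_mul (W p.1)).mul (((hχ n).differentiable one_ne_zero) p.2).hasDerivAt
    · refine HasCompactSupport.of_support_subset_isCompact (hXc.isCompact.prod (hχc n).isCompact) ?_
      intro p hp
      have := mul_ne_zero_iff.1 (Function.mem_support.1 hp)
      exact ⟨subset_tsupport _ this.1, subset_tsupport _ this.2⟩
    · refine HasCompactSupport.of_support_subset_isCompact (hWc.isCompact.prod (hχc n).isCompact) ?_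
      intro p hp
      have := mul_ne_zero_iff.1 (Function.mem_support.1 hp)
      exact ⟨subset_tsupport _ (mul_ne_zero_iff.1 this.1).1, subset_tsupport _ this.2⟩
    · intro p
      have h1 := hXW p.1
      have h2 : s p ^ 2 ≤ 1 := (sq_le_one_iff_abs_le_one _).2 (hs1 p)
      have h3 : χ n p.2 ^ 2 ≤ 1 := pow_le_one₀ (hχ1 n _).1 (hχ1 n _).2
      calc _ = (X p.1 ^ 2 + W p.1 ^ 2 * s p ^ 2) * χ n p.2 ^ 2 := by ring
        _ ≤ (X p.1 ^ 2 + W p.1 ^ 2 * 1) * χ n p.2 ^ 2 := by gcongr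
        _ ≤ 1 * 1 := by rw [mul_one]; gcongr
        _ = 1 := one_mul 1
  refine le_of_tendsto' (x := atTop) ?_ hF
  apply tendsto_integral_of_dominated_convergence
    (fun p => (Icc (-R) R ×ˢ univ).indicator (fun _ => M + (C + C')) p)
  · intro n
    have h1 := (hX.continuous_deriv le_rfl)
    have h2 := (hχ n).continuous_deriv le_rfl
    have h3 := (hχ n).continuous
    have h4 := hW.continuous
    have h5 := hs.continuous
    exact (by fun_prop : Continuous (F n)).aestronglyMeasurable
  · rw [integrable_indicator_iff (by measurability), IntegrableOn,
      Measure.restrict_restrict (by measurability), inter_comm]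
    exact integrableOn_const (hfin R).ne
  · intro n
    refine Eventually.of_forall fun p => ?_
    by_cases hp : p.1 ∈ Icc (-R) R
    · rw [indicator_of_mem (show p ∈ Icc (-R) R ×ˢ univ from ⟨hp, mem_univ _⟩)]
      have a1 : ‖deriv X p.1 * χ n p.2‖ ≤ M * 1 := by
        rw [norm_mul]
        refine mul_le_mul (hM _) ?_ (norm_nonneg _) hM0
        rw [Real.norm_of_nonneg (hχ1 _ _).1]
        exact (hχ1 _ _).2
      have a2 : ‖W p.1 * k p * χ n p.2‖ ≤ 1 * C * 1 := by
        rw [norm_mul, norm_mul]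
        have : ‖χ n p.2‖ ≤ 1 := by
          rw [Real.norm_of_nonneg (hχ1 _ _).1]
          exact (hχ1 _ _).2
        gcongr
        · exact hW1 _
        · exact hkC _
      have a3 : ‖W p.1 * s p * deriv (χ n) p.2‖ ≤ 1 * 1 * C' := by
        rw [norm_mul, norm_mul]
        gcongr
        · exact hW1 _
        · exact hs1 _
        · exact hχC _ _
      calc ‖F n p‖ ≤ ‖deriv X p.1 * χ n p.2‖ + (‖W p.1 * k p * χ n p.2‖ +
          ‖W p.1 * s p * deriv (χ n) p.2‖) :=
            (norm_add_le _ _).trans (by gcongr; exact norm_add_le _ _)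
        _ ≤ M + (C + C') := by linarith
    · rw [indicator_of_notMem (fun h => hp h.1)]
      obtain ⟨e1, e2, e3⟩ := hR _ hp
      simp [F, e2, e3]
  · refine Eventually.of_forall fun p => ?_
    have := ((hχl p.2).const_mul (deriv X p.1)).add
      (((hχl p.2).const_mul (W p.1 * k p)).add ((hχd p.2).const_mul (W p.1 * s p)))
    simpa [F] using this

open scoped Manifold ContDiff in
lemma exists_contDiff_approx_indicator {K : Set (ℝ × ℝ)} (hK : MeasurableSet K)
    (hfin : volume K ≠ ⊤) {δ : ℝ} (hδ : 0 < δ) :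
    ∃ h : ℝ × ℝ → ℝ, ContDiff ℝ 1 h ∧ HasCompactSupport h ∧ (∀ p, 0 ≤ h p ∧ h p ≤ 1) ∧
      ∫ p, |h p - K.indicator 1 p| ≤ δ := by
  have hδ' : ENNReal.ofReal (δ / 2) ≠ 0 := by simpa using hδ
  obtain ⟨C, hCK, hC, hCm⟩ := hK.exists_isCompact_sdiff_lt hfin hδ'
  obtain ⟨U, hKU, hU, -, hUm⟩ := hK.exists_isOpen_sdiff_lt hfin hδ'
  obtain ⟨R, hR⟩ := hC.isBounded.subset_ball 0
  let V := U ∩ Metric.ball 0 R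
  have hV : IsOpen V := hU.inter Metric.isOpen_ball
  have hCV : C ⊆ V := fun x hx => ⟨hKU (hCK hx), hR hx⟩
  obtain ⟨f, hf0, hf1, hf⟩ := exists_contMDiffMap_zero_one_of_isClosed (n := 1) 𝓘(ℝ, ℝ × ℝ)
    hV.isClosed_compl hC.isClosed (disjoint_compl_left_iff_subset.2 hCV)
  refine ⟨f, f.contMDiff.contDiff, ?_, hf, ?_⟩
  · refine HasCompactSupport.of_support_subset_isCompact (isCompact_closedBall 0 R) ?_
    intro x hx
    by_contra h
    exact hx (hf0 fun h' => h (Metric.ball_subset_closedBall h'.2))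
  · have hUC : volume (U \ C) < ENNReal.ofReal δ := by
      have : U \ C ⊆ (U \ K) ∪ (K \ C) := fun x hx => by
        by_cases h : x ∈ K
        · exact Or.inr ⟨h, hx.2⟩
        · exact Or.inl ⟨hx.1, h⟩
      calc volume (U \ C) ≤ volume (U \ K) + volume (K \ C) :=
            (measure_mono this).trans (measure_union_le _ _)
        _ < ENNReal.ofReal (δ / 2) + ENNReal.ofReal (δ / 2) := ENNReal.add_lt_add hUm hCm
        _ = ENNReal.ofReal δ := by
            rw [← ENNReal.ofReal_add (by positivity) (by positivity), add_halves]
    have hUCm : MeasurableSet (U \ C) := hU.measurableSet.diff hC.measurableSet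
    calc ∫ p, |f p - K.indicator 1 p| ≤ ∫ p, (U \ C).indicator (fun _ => (1 : ℝ)) p := by
          refine integral_mono_of_nonneg (Eventually.of_forall fun p => abs_nonneg _) ?_
            (Eventually.of_forall fun p => ?_)
          · exact (integrable_indicator_iff hUCm).2 (integrableOn_const hUC.ne_top)
          · dsimp only
            by_cases hpC : p ∈ C
            · rw [hf1 hpC, indicator_of_mem (hCK hpC)]
              simp only [Pi.one_apply, sub_self, abs_zero]
              exact indicator_nonneg (fun _ _ => zero_le_one) _
            by_cases hpU : p ∈ U
            · rw [indicator_of_mem (show p ∈ U \ C from ⟨hpU, hpC⟩)]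
              have h1 := hf p
              by_cases hpK : p ∈ K
              · rw [indicator_of_mem hpK, abs_le]
                simp only [Pi.one_apply]
                constructor <;> linarith [h1.1, h1.2]
              · rw [indicator_of_notMem hpK, abs_le]
                constructor <;> linarith [h1.1, h1.2]
            · have hpK : p ∉ K := fun h => hpU (hKU h)
              rw [hf0 (fun h => hpU h.1), indicator_of_notMem hpK]
              simp only [Pi.zero_apply, sub_self, abs_zero]
              exact indicator_nonneg (fun _ _ => zero_le_one) _
      _ = volume.real (U \ C) := by
          rw [integral_indicator hUCm]; simp
      _ ≤ δ := ENNReal.toReal_le_of_le_ofReal hδ.le hUC.le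

lemma hasCompactSupport_slice {h : ℝ × ℝ → ℝ} (hc : HasCompactSupport h) (x : ℝ) :
    HasCompactSupport fun t => h (x, t) := by
  refine HasCompactSupport.of_support_subset_isCompact (hc.isCompact.image continuous_snd) ?_
  exact fun t ht => ⟨(x, t), subset_tsupport _ ht, rfl⟩

lemma integrable_slice {h : ℝ × ℝ → ℝ} (hh : Continuous h) (hc : HasCompactSupport h) (x : ℝ) :
    Integrable fun t => h (x, t) :=
  (by fun_prop : Continuous fun t => h (x, t)).integrable_of_hasCompactSupport
    (hasCompactSupport_slice hc x)

lemma contDiff_integral_slice_restrict {h : ℝ × ℝ → ℝ} (hh : ContDiff ℝ 1 h)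
    (hc : HasCompactSupport h) (A : Set ℝ) :
    ContDiff ℝ 1 fun p : ℝ × ℝ => ∫ τ in A, h (p.1, p.2 - τ) := by
  let μ : Measure (ℝ × ℝ) := (Measure.dirac 0).prod (volume.restrict A)
  have h1 : LocallyIntegrable (fun _ : ℝ × ℝ => (1 : ℝ)) μ := locallyIntegrable_const 1
  have key := hc.contDiff_convolution_right (n := 1) (ContinuousLinearMap.mul ℝ ℝ) h1 hh
  suffices e : (fun p : ℝ × ℝ => ∫ τ in A, h (p.1, p.2 - τ)) =
      convolution (fun _ => (1 : ℝ)) h (ContinuousLinearMap.mul ℝ ℝ) μ by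
    rw [e]
    exact key
  funext p
  rw [convolution_def, show μ = _ from Measure.dirac_prod 0, integral_map]
  · simp only [ContinuousLinearMap.mul_apply', one_mul]
    refine integral_congr_ae (Eventually.of_forall fun τ => ?_)
    change h (p.1, p.2 - τ) = h (p.1 - 0, p.2 - τ)
    rw [sub_zero]
  · fun_prop
  · have := hh.continuous
    exact (by fun_prop : Continuous fun t : ℝ × ℝ =>
      ContinuousLinearMap.mul ℝ ℝ 1 (h (p - t))).aestronglyMeasurable

lemma integral_Ioi_slice {h : ℝ × ℝ → ℝ} (x y : ℝ) :
    ∫ τ in Ioi 0, h (x, y - τ) = ∫ t in Iic y, h (x, t) := by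
  rw [integral_Iic_eq_integral_Iio, ← integral_indicator measurableSet_Ioi,
    ← integral_indicator measurableSet_Iio,
    ← integral_sub_left_eq_self ((Iio y).indicator fun t => h (x, t)) volume y]
  refine integral_congr_ae (Eventually.of_forall fun τ => ?_)
  simp [indicator]

/-- A smooth transition in the second variable whose speed is proportional to `h`. -/
lemma exists_transition {h : ℝ × ℝ → ℝ} (hh : ContDiff ℝ 1 h) (hc : HasCompactSupport h)
    (h0 : ∀ p, 0 ≤ h p) {ε : ℝ} (hε : 0 < ε) :
    ∃ s : ℝ × ℝ → ℝ, ContDiff ℝ 1 s ∧ (∀ p, |s p| ≤ 1) ∧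
      (∀ p, fderiv ℝ s p (0, 1) = 2 * h p / ((∫ t, h (p.1, t)) + ε)) ∧
      Continuous fun x => ∫ t, h (x, t) := by
  let H : ℝ × ℝ → ℝ := fun p => ∫ τ in Ioi 0, h (p.1, p.2 - τ)
  let N : ℝ × ℝ → ℝ := fun p => ∫ τ in univ, h (p.1, p.2 - τ)
  have hH : ContDiff ℝ 1 H := contDiff_integral_slice_restrict hh hc _
  have hN : ContDiff ℝ 1 N := contDiff_integral_slice_restrict hh hc _
  have hNe : ∀ p, N p = ∫ t, h (p.1, t) := fun p => by
    simp only [N, Measure.restrict_univ]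
    exact integral_sub_left_eq_self (fun t => h (p.1, t)) volume p.2
  have hHe : ∀ p, H p = ∫ t in Iic p.2, h (p.1, t) := fun p => integral_Ioi_slice p.1 p.2
  have hi : ∀ x, Integrable fun t => h (x, t) := integrable_slice hh.continuous hc
  have hH0 : ∀ p, 0 ≤ H p := fun p => integral_nonneg fun _ => h0 _
  have hHN : ∀ p, H p ≤ N p := fun p => by
    rw [hHe, hNe]
    exact setIntegral_le_integral (hi _) (Eventually.of_forall fun _ => h0 _)
  have hpos : ∀ p, 0 < N p + ε := fun p => by linarith [hH0 p, hHN p]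
  have hs : ContDiff ℝ 1 fun p => -1 + 2 * H p / (N p + ε) :=
    contDiff_const.add ((contDiff_const.mul hH).div (hN.add contDiff_const) fun p => (hpos p).ne')
  refine ⟨fun p => -1 + 2 * H p / (N p + ε), hs, fun p => ?_, fun p => ?_, ?_⟩
  · have h1 : 0 ≤ 2 * H p / (N p + ε) := div_nonneg (by linarith [hH0 p]) (hpos p).le
    have h2 : 2 * H p / (N p + ε) ≤ 2 := by
      rw [div_le_iff₀ (hpos p)]
      linarith [hHN p]
    rw [abs_le]
    constructor <;> linarith
  · refine fderiv_apply_zero_one_eq (hs.differentiable one_ne_zero p) ?_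
    have hd : HasDerivAt (fun t => H (p.1, t)) (h p) p.2 := by
      have hcs : Continuous fun t => h (p.1, t) := by
        have := hh.continuous
        fun_prop
      have e : (fun t => H (p.1, t)) = fun t =>
          (∫ t in Iic (0 : ℝ), h (p.1, t)) + ∫ t in (0 : ℝ)..t, h (p.1, t) := by
        funext t
        rw [← intervalIntegral.integral_Iic_sub_Iic (hi p.1).integrableOn (hi p.1).integrableOn,
          hHe]
        ring
      rw [e]
      exact (intervalIntegral.integral_hasDerivAt_right (hcs.intervalIntegrable _ _)
        (hcs.stronglyMeasurableAtFilter _ _) hcs.continuousAt).const_add _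
    have := ((hd.const_mul 2).div_const (N p + ε)).const_add (-1)
    rw [hNe] at this
    simpa only [hNe] using this
  · have : (fun x => ∫ t, h (x, t)) = fun x => N (x, 0) := funext fun x => (hNe (x, 0)).symm
    rw [this]
    have := hN.continuous
    fun_prop

/-- The points of the line over which the slice of `S` has positive length. -/
def shadow (S : Set (ℝ × ℝ)) : Set ℝ := {x | volume (Prod.mk x ⁻¹' S) ≠ 0}

lemma measurableSet_shadow {S : Set (ℝ × ℝ)} (hS : MeasurableSet S) :
    MeasurableSet (shadow S) :=
  measurable_measure_prodMk_left hS (measurableSet_singleton 0).compl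

lemma div_add_sub_le {l N ε : ℝ} (hl : 0 ≤ l) (hN : 0 ≤ N) (hε : 0 < ε) :
    l / (l + ε) - |N - l| / ε ≤ N / (N + ε) := by
  have h1 : l / (l + ε) - N / (N + ε) = (l - N) * (ε / ((l + ε) * (N + ε))) := by
    field_simp
    ring
  have h2 : ε / ((l + ε) * (N + ε)) ≤ 1 / ε := by
    rw [div_le_div_iff₀ (by positivity) hε]
    nlinarith [mul_nonneg hl hN, mul_nonneg hl hε.le, mul_nonneg hN hε.le]
  have h3 : (l - N) * (ε / ((l + ε) * (N + ε))) ≤ |N - l| * (1 / ε) := by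
    rw [abs_sub_comm]
    have : 0 ≤ ε / ((l + ε) * (N + ε)) := by positivity
    exact mul_le_mul (le_abs_self _) h2 this (abs_nonneg _)
  rw [mul_one_div] at h3
  linarith

lemma integrableOn_comp_fst {S : Set (ℝ × ℝ)}
    (hfin : ∀ R : ℝ, volume (S ∩ Icc (-R) R ×ˢ univ) < ⊤) {f : ℝ → ℝ} (hf : Continuous f)
    (hfc : HasCompactSupport f) : IntegrableOn (fun p : ℝ × ℝ => f p.1) S := by
  obtain ⟨R, hR⟩ := hfc.isCompact.isBounded.subset_closedBall 0
  obtain ⟨M, hM⟩ := hfc.exists_bound_of_continuous hf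
  have h1 : IntegrableOn (fun _ : ℝ × ℝ => M) (S ∩ Icc (-R) R ×ˢ univ) :=
    integrableOn_const (hfin R).ne
  have h2 : IntegrableOn (fun p : ℝ × ℝ => f p.1) (S ∩ Icc (-R) R ×ˢ univ) :=
    Integrable.mono' h1 (by fun_prop : Continuous fun p : ℝ × ℝ => f p.1).aestronglyMeasurable
      (Eventually.of_forall fun p => hM p.1)
  rw [IntegrableOn, inter_comm, ← Measure.restrict_restrict (by measurability)] at h2
  refine (integrableOn_iff_integrable_of_support_subset fun p hp => ?_).1 h2
  have := hR (subset_tsupport _ hp)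
  rw [mem_closedBall_zero_iff, Real.norm_eq_abs, abs_le] at this
  exact ⟨this, mem_univ _⟩

lemma PlanarPerimeterLE.regularized_shadow_le {S : Set (ℝ × ℝ)} {P : ℝ} (hS : MeasurableSet S)
    (hP : PlanarPerimeterLE S P) (hfin : ∀ R : ℝ, volume (S ∩ Icc (-R) R ×ˢ univ) < ⊤)
    {X W : ℝ → ℝ} (hX : ContDiff ℝ 1 X) (hW : ContDiff ℝ 1 W) (hXc : HasCompactSupport X)
    (hWc : HasCompactSupport W) (hW0 : ∀ x, 0 ≤ W x) (hXW : ∀ x, X x ^ 2 + W x ^ 2 ≤ 1)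
    {K : Set (ℝ × ℝ)} (hK : MeasurableSet K) (hKS : K ⊆ S) (hKfin : volume K ≠ ⊤)
    {ε : ℝ} (hε : 0 < ε) :
    (∫ p in S, deriv X p.1) + ∫ x, 2 * W x *
      (volume.real (Prod.mk x ⁻¹' K) / (volume.real (Prod.mk x ⁻¹' K) + ε)) ≤ P := by
  refine le_of_forall_pos_le_add fun η hη => ?_
  obtain ⟨h, hh, hhc, hh01, hδ⟩ := exists_contDiff_approx_indicator hK hKfin
    (show 0 < η * ε / 4 by positivity)
  obtain ⟨s, hs, hs1, hsk, hN⟩ := exists_transition hh hhc (fun p => (hh01 p).1) hε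
  let N : ℝ → ℝ := fun x => ∫ t, h (x, t)
  let l : ℝ → ℝ := fun x => volume.real (Prod.mk x ⁻¹' K)
  let k : ℝ × ℝ → ℝ := fun p => 2 * h p / (N p.1 + ε)
  let D : ℝ × ℝ → ℝ := fun p => |h p - K.indicator 1 p|
  have hN : Continuous N := hN
  have hN0 : ∀ x, 0 ≤ N x := fun x => integral_nonneg fun t => (hh01 _).1
  have hNε : ∀ x, 0 < N x + ε := fun x => by linarith [hN0 x]
  have hhcont := hh.continuous
  have hWcont := hW.continuous
  have hk : Continuous k := Continuous.div (by fun_prop) (by fun_prop) fun p => (hNε p.1).ne'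
  have hk0 : ∀ p, 0 ≤ k p := fun p => div_nonneg (by linarith [(hh01 p).1]) (hNε p.1).le
  have hkh : ∀ p, k p ≤ 2 / ε * h p := fun p => by
    rw [div_mul_eq_mul_div]
    refine div_le_div_of_nonneg_left (by linarith [(hh01 p).1]) hε ?_
    linarith [hN0 p.1]
  have hkC : ∀ p, |k p| ≤ 2 / ε := fun p => by
    rw [abs_of_nonneg (hk0 p)]
    exact (hkh p).trans (mul_le_of_le_one_right (by positivity) (hh01 p).2)
  have hW1 : ∀ x, W x ≤ 1 := fun x => by nlinarith [hXW x, sq_nonneg (X x), hW0 x]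
  have key := hP.integral_le hfin hX hW hXc hWc hXW hs hs1 hk hsk hkC
  have hWk : Integrable fun p : ℝ × ℝ => W p.1 * k p := by
    refine (by fun_prop : Continuous fun p : ℝ × ℝ => W p.1 * k p).integrable_of_hasCompactSupport
      (HasCompactSupport.of_support_subset_isCompact hhc.isCompact fun p hp => ?_)
    refine subset_tsupport _ fun h0 => hp ?_
    simp [k, h0]
  have hX' : IntegrableOn (fun p : ℝ × ℝ => deriv X p.1) S :=
    integrableOn_comp_fst hfin (hX.continuous_deriv le_rfl) hXc.deriv
  rw [integral_add hX' hWk.integrableOn] at key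
  have hKi : Integrable (K.indicator (1 : ℝ × ℝ → ℝ)) :=
    (integrable_indicator_iff hK).2 (integrableOn_const hKfin)
  have hdiff : Integrable fun p => h p - K.indicator 1 p :=
    (hhcont.integrable_of_hasCompactSupport hhc).sub hKi
  have hD : Integrable D := hdiff.abs
  have e1 : (∫ p, W p.1 * k p) - 2 / ε * ∫ p, D p ≤ ∫ p in S, W p.1 * k p := by
    rw [← integral_indicator hS, ← integral_const_mul, ← integral_sub hWk (hD.const_mul _)]
    refine integral_mono (hWk.sub (hD.const_mul _)) (hWk.indicator hS) fun p => ?_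
    by_cases hp : p ∈ S
    · rw [indicator_of_mem hp]
      have : 0 ≤ 2 / ε * D p := mul_nonneg (by positivity) (abs_nonneg _)
      linarith
    · rw [indicator_of_notMem hp]
      have hpK : p ∉ K := fun h => hp (hKS h)
      have e : D p = h p := by
        simp [D, hpK, abs_of_nonneg (hh01 p).1]
      have : W p.1 * k p ≤ 1 * k p := mul_le_mul_of_nonneg_right (hW1 _) (hk0 p)
      dsimp only
      rw [e]
      linarith [hkh p]
  have e2 : ∫ p, W p.1 * k p = ∫ x, 2 * W x * (N x / (N x + ε)) := by
    rw [Measure.volume_eq_prod, integral_prod _ hWk]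
    refine integral_congr_ae (Eventually.of_forall fun x => ?_)
    simp only [k]
    rw [integral_const_mul, integral_div, integral_const_mul]
    ring
  have e3 : ∀ᵐ x, |N x - l x| ≤ ∫ y, D (x, y) := by
    filter_upwards [hKi.prod_right_ae] with x hx
    have hl : l x = ∫ y, K.indicator 1 (x, y) := by
      have : (fun y => K.indicator (1 : ℝ × ℝ → ℝ) (x, y)) = (Prod.mk x ⁻¹' K).indicator 1 := by
        ext y
        rfl
      rw [this, integral_indicator_one (measurable_prodMk_left hK)]
    rw [hl, ← integral_sub (integrable_slice hhcont hhc x) hx]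
    exact abs_integral_le_integral_abs
  have hi1 : Integrable fun x => 2 * W x * (N x / (N x + ε)) := by
    refine (Continuous.mul (by fun_prop) (hN.div (by fun_prop)
      fun x => (hNε x).ne')).integrable_of_hasCompactSupport
      (HasCompactSupport.of_support_subset_isCompact hWc.isCompact fun p hp => ?_)
    refine subset_tsupport _ fun h0 => hp ?_
    simp [h0]
  have hD' : Integrable fun x => 2 / ε * ∫ y, D (x, y) := hD.integral_prod_left.const_mul _
  have e4 : ∫ x, 2 * W x * (l x / (l x + ε)) ≤
      ∫ x, (2 * W x * (N x / (N x + ε)) + 2 / ε * ∫ y, D (x, y)) := by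
    refine integral_mono_of_nonneg (Eventually.of_forall fun x => ?_)
      (hi1.add hD') ?_
    · have := hW0 x
      have : 0 ≤ l x := measureReal_nonneg
      dsimp only [Pi.zero_apply]
      positivity
    · filter_upwards [e3] with x hx
      have a1 := div_add_sub_le (measureReal_nonneg : 0 ≤ l x) (hN0 x) hε
      have a2 : |N x - l x| / ε ≤ (∫ y, D (x, y)) / ε := by gcongr
      have a3 : W x * ((∫ y, D (x, y)) / ε) ≤ 1 * ((∫ y, D (x, y)) / ε) :=
        mul_le_mul_of_nonneg_right (hW1 x)
          (div_nonneg (integral_nonneg fun _ => abs_nonneg _) hε.le)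
      have a4 : W x * (l x / (l x + ε) - N x / (N x + ε)) ≤ W x * ((∫ y, D (x, y)) / ε) :=
        mul_le_mul_of_nonneg_left (by linarith) (hW0 x)
      have : 2 / ε * ∫ y, D (x, y) = 2 * ((∫ y, D (x, y)) / ε) := by ring
      rw [this]
      nlinarith
  have e5 : ∫ x, ∫ y, D (x, y) = ∫ p, D p := by
    rw [Measure.volume_eq_prod, integral_prod _ hD]
  have e6 : 2 / ε * ∫ p, D p ≤ η / 2 := by
    calc 2 / ε * ∫ p, D p ≤ 2 / ε * (η * ε / 4) := by gcongr
      _ = η / 2 := by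
        field_simp
        ring
  rw [integral_add hi1 hD', integral_const_mul, e5] at e4
  linarith

lemma PlanarPerimeterLE.shadow_le {S : Set (ℝ × ℝ)} {P : ℝ} (hS : MeasurableSet S)
    (hP : PlanarPerimeterLE S P) (hfin : ∀ R : ℝ, volume (S ∩ Icc (-R) R ×ˢ univ) < ⊤)
    {X W : ℝ → ℝ} (hX : ContDiff ℝ 1 X) (hW : ContDiff ℝ 1 W) (hXc : HasCompactSupport X)
    (hWc : HasCompactSupport W) (hW0 : ∀ x, 0 ≤ W x) (hXW : ∀ x, X x ^ 2 + W x ^ 2 ≤ 1) :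
    (∫ p in S, deriv X p.1) + 2 * ∫ x in shadow S, W x ≤ P := by
  obtain ⟨R, hR⟩ := hWc.isCompact.isBounded.subset_closedBall 0
  have hWR : ∀ x, x ∉ Icc (-R) R → W x = 0 := fun x hx => by
    refine image_eq_zero_of_notMem_tsupport fun h => hx ?_
    have := hR h
    rwa [mem_closedBall_zero_iff, Real.norm_eq_abs, abs_le] at this
  let K := S ∩ Icc (-R) R ×ˢ univ
  have hK : MeasurableSet K := hS.inter (measurableSet_Icc.prod .univ)
  have hKfin : volume K ≠ ⊤ := (hfin R).ne
  let l : ℝ → ℝ := fun x => volume.real (Prod.mk x ⁻¹' K)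
  have hlm : Measurable l := (measurable_measure_prodMk_left hK).ennreal_toReal
  have hl0 : ∀ x, 0 ≤ l x := fun x => measureReal_nonneg
  have hWi : Integrable W := hW.continuous.integrable_of_hasCompactSupport hWc
  have hlim : Tendsto (fun n : ℕ => (∫ p in S, deriv X p.1) +
      ∫ x, 2 * W x * (l x / (l x + ((n : ℝ) + 1)⁻¹))) atTop
      (𝓝 ((∫ p in S, deriv X p.1) + ∫ x, (shadow S).indicator (fun x => 2 * W x) x)) := by
    refine tendsto_const_nhds.add ?_
    refine tendsto_integral_of_dominated_convergence (fun x => 2 * W x) ?_ (hWi.const_mul 2) ?_ ?_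
    · intro n
      have := hW.continuous.measurable
      exact (by fun_prop : Measurable fun x => 2 * W x * (l x / (l x + ((n : ℝ) + 1)⁻¹))
        ).aestronglyMeasurable
    · refine fun n => Eventually.of_forall fun x => ?_
      have h1 : 0 ≤ l x / (l x + ((n : ℝ) + 1)⁻¹) :=
        div_nonneg (hl0 x) (by have := hl0 x; positivity)
      have h2 : l x / (l x + ((n : ℝ) + 1)⁻¹) ≤ 1 := by
        refine div_le_one_of_le₀ ?_ (by have := hl0 x; positivity)
        have : 0 ≤ ((n : ℝ) + 1)⁻¹ := by positivity
        linarith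
      have h3 := hW0 x
      rw [Real.norm_of_nonneg (by positivity)]
      exact mul_le_of_le_one_right (by positivity) h2
    · have hae : ∀ᵐ x : ℝ, volume (Prod.mk x ⁻¹' K) < ⊤ :=
        Measure.ae_measure_lt_top hK hKfin
      filter_upwards [hae] with x hx
      by_cases hxR : x ∈ Icc (-R) R
      · have hKx : Prod.mk x ⁻¹' K = Prod.mk x ⁻¹' S := by
          ext y
          simp [K, hxR.1, hxR.2]
        by_cases hxs : x ∈ shadow S
        · rw [indicator_of_mem hxs]
          have hl : 0 < l x := by
            refine ENNReal.toReal_pos ?_ hx.ne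
            rw [hKx]
            exact hxs
          have h0 : Tendsto (fun n : ℕ => ((n : ℝ) + 1)⁻¹) atTop (𝓝 0) := by
            simpa using tendsto_one_div_add_atTop_nhds_zero_nat (𝕜 := ℝ)
          have := ((tendsto_const_nhds (x := l x)).div (h0.const_add (l x))
            (by simpa using hl.ne')).const_mul (2 * W x)
          simpa [div_self hl.ne'] using this
        · rw [indicator_of_notMem hxs]
          have hl : l x = 0 := by
            have : volume (Prod.mk x ⁻¹' S) = 0 := not_not.1 hxs
            simp [l, hKx, measureReal_def, this]
          simp [hl]
      · simp [indicator, hWR x hxR]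
  have := le_of_tendsto' hlim fun n => hP.regularized_shadow_le hS hfin hX hW hXc hWc hW0 hXW hK
    inter_subset_left hKfin (by positivity : (0 : ℝ) < ((n : ℝ) + 1)⁻¹)
  rwa [integral_indicator (measurableSet_shadow hS), integral_const_mul] at this

lemma PlanarPerimeterLE.volume_shadow_le {S : Set (ℝ × ℝ)} {P : ℝ} (hS : MeasurableSet S)
    (hP : PlanarPerimeterLE S P) (hfin : ∀ R : ℝ, volume (S ∩ Icc (-R) R ×ˢ univ) < ⊤) :
    volume (shadow S) ≤ ENNReal.ofReal (P / 2) := by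
  obtain ⟨χ, C', hχ, hχc, hχ1, hχl, hχC, hχd⟩ := exists_cutoff_seq
  have h1 : ∀ n, ∫⁻ x in shadow S, ENNReal.ofReal (χ n x) ≤ ENNReal.ofReal (P / 2) := by
    intro n
    have := hP.shadow_le hS hfin (X := 0) contDiff_const (hχ n) HasCompactSupport.zero (hχc n)
      (fun x => (hχ1 n x).1) (fun x => by
        have := hχ1 n x
        simp only [Pi.zero_apply]
        nlinarith)
    have e : ∫ p in S, deriv (0 : ℝ → ℝ) p.1 = 0 := by simp
    rw [e] at this
    rw [← ofReal_integral_eq_lintegral_ofReal]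
    · exact ENNReal.ofReal_le_ofReal (by linarith)
    · exact ((hχ n).continuous.integrable_of_hasCompactSupport (hχc n)).integrableOn
    · exact Eventually.of_forall fun x => (hχ1 n x).1
  have h2 : ∀ x, liminf (fun n => ENNReal.ofReal (χ n x)) atTop = 1 := fun x => by
    have : Tendsto (fun n => ENNReal.ofReal (χ n x)) atTop (𝓝 (ENNReal.ofReal 1)) :=
      ENNReal.tendsto_ofReal (hχl x)
    simpa using this.liminf_eq
  calc volume (shadow S) = ∫⁻ x in shadow S, liminf (fun n => ENNReal.ofReal (χ n x)) atTop := by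
        simp [h2]
    _ ≤ liminf (fun n => ∫⁻ x in shadow S, ENNReal.ofReal (χ n x)) atTop :=
        lintegral_liminf_le fun n => (hχ n).continuous.measurable.ennreal_ofReal
    _ ≤ ENNReal.ofReal (P / 2) := by
        refine (liminf_le_liminf (Eventually.of_forall h1)).trans ?_
        simp

lemma tendsto_one_sub_inv : Tendsto (fun n : ℕ => 1 - ((n : ℝ) + 2)⁻¹) atTop (𝓝 1) := by
  have : Tendsto (fun n : ℕ => ((n : ℝ) + 2)⁻¹) atTop (𝓝 0) :=
    tendsto_inv_atTop_zero.comp (tendsto_atTop_add_const_right _ _ tendsto_natCast_atTop_atTop)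
  simpa using this.const_sub 1

lemma PlanarPerimeterLE.profile_le_of_contDiff {S : Set (ℝ × ℝ)} {P : ℝ} (hS : MeasurableSet S)
    (hP : PlanarPerimeterLE S P) (hSfin : volume S ≠ ⊤) (hsh : volume (shadow S) ≠ ⊤)
    {Y : ℝ → ℝ} (hY : ContDiff ℝ 1 Y) (hY1 : ∀ x, |Y x| ≤ 1)
    (hYi : IntegrableOn (fun p : ℝ × ℝ => deriv Y p.1) S) :
    (∫ p in S, deriv Y p.1) + 2 * ∫ x in shadow S, √(1 - Y x ^ 2) ≤ P := by
  obtain ⟨χ, C, hχ, hχc, hχ1, hχl, hχC, hχd⟩ := exists_cutoff_seq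
  have hfin : ∀ R : ℝ, volume (S ∩ Icc (-R) R ×ˢ univ) < ⊤ := fun R =>
    (measure_mono inter_subset_left).trans_lt hSfin.lt_top
  let c : ℕ → ℝ := fun n => 1 - ((n : ℝ) + 2)⁻¹
  have hc0 : ∀ n, 0 ≤ c n := fun n => by
    have : ((n : ℝ) + 2)⁻¹ ≤ 1 := inv_le_one_of_one_le₀ (by linarith [n.cast_nonneg (α := ℝ)])
    simp only [c]
    linarith
  have hc1 : ∀ n, c n < 1 := fun n => by
    have : 0 < ((n : ℝ) + 2)⁻¹ := by positivity
    simp only [c]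
    linarith
  have hcY : ∀ n x, (c n * Y x) ^ 2 < 1 := fun n x => by
    rw [sq_lt_one_iff_abs_lt_one, abs_mul, abs_of_nonneg (hc0 n)]
    have := mul_le_of_le_one_right (hc0 n) (hY1 x)
    linarith [hc1 n]
  have hX : ∀ n, ContDiff ℝ 1 fun x => χ n x * (c n * Y x) := fun n => by
    have := hχ n
    fun_prop
  have hW : ∀ n, ContDiff ℝ 1 fun x => χ n x * √(1 - (c n * Y x) ^ 2) := fun n =>
    (hχ n).mul (ContDiff.sqrt (by fun_prop) fun x => by linarith [hcY n x])
  have hd : ∀ n x, deriv (fun x => χ n x * (c n * Y x)) x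
      = deriv (χ n) x * (c n * Y x) + χ n x * (c n * deriv Y x) := fun n x =>
    (((hχ n).differentiable one_ne_zero x).hasDerivAt.mul
      (((hY.differentiable one_ne_zero) x).hasDerivAt.const_mul (c n))).deriv
  have hYc := hY.continuous
  have hY'c := hY.continuous_deriv le_rfl
  refine le_of_tendsto' (x := atTop) (f := fun n =>
    (∫ p in S, deriv (fun x => χ n x * (c n * Y x)) p.1) +
      2 * ∫ x in shadow S, χ n x * √(1 - (c n * Y x) ^ 2)) ?_ fun n => ?_
  · refine Tendsto.add ?_ (Tendsto.const_mul 2 ?_)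
    · refine tendsto_integral_of_dominated_convergence (fun p => C + ‖deriv Y p.1‖) ?_ ?_ ?_ ?_
      · intro n
        have := (hX n).continuous_deriv le_rfl
        exact (by fun_prop : Continuous fun p : ℝ × ℝ =>
          deriv (fun x => χ n x * (c n * Y x)) p.1).aestronglyMeasurable
      · exact (integrableOn_const hSfin).add hYi.norm
      · refine fun n => Eventually.of_forall fun p => ?_
        rw [hd]
        refine (norm_add_le _ _).trans (add_le_add ?_ ?_)
        · rw [norm_mul, norm_mul, Real.norm_of_nonneg (hc0 n)]
          have h1 := hχC n p.1
          have h2 := hY1 p.1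
          have h3 : c n * ‖Y p.1‖ ≤ 1 := mul_le_one₀ (hc1 n).le (norm_nonneg _) h2
          calc _ ≤ C * 1 := mul_le_mul h1 h3 (mul_nonneg (hc0 n) (norm_nonneg _))
                ((abs_nonneg _).trans h1)
            _ = C := mul_one C
        · rw [norm_mul, norm_mul, Real.norm_of_nonneg (hc0 n), Real.norm_of_nonneg (hχ1 n _).1,
            ← mul_assoc]
          exact mul_le_of_le_one_left (norm_nonneg _)
            (mul_le_one₀ (hχ1 n _).2 (hc0 n) (hc1 n).le)
      · refine Eventually.of_forall fun p => ?_
        simp only [hd]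
        have h1 := tendsto_one_sub_inv
        simpa using ((hχd p.1).mul (h1.mul_const (Y p.1))).add
          ((hχl p.1).mul (h1.mul_const (deriv Y p.1)))
    · refine tendsto_integral_of_dominated_convergence (fun p => 1) ?_ ?_ ?_ ?_
      · exact fun n => (hW n).continuous.aestronglyMeasurable
      · exact integrableOn_const hsh
      · refine fun n => Eventually.of_forall fun x => ?_
        rw [norm_mul, Real.norm_of_nonneg (hχ1 n _).1, Real.norm_of_nonneg (Real.sqrt_nonneg _)]
        exact mul_le_one₀ (hχ1 n _).2 (Real.sqrt_nonneg _)
          (Real.sqrt_le_one.2 (by linarith [sq_nonneg (c n * Y x)]))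
      · refine Eventually.of_forall fun x => ?_
        have h1 := ((tendsto_one_sub_inv.mul_const (Y x)).pow 2).const_sub 1
        simpa using (hχl x).mul ((Real.continuous_sqrt.tendsto _).comp h1)
  · refine hP.shadow_le hS hfin (hX n) (hW n) (hχc n).mul_right (hχc n).mul_right
      (fun x => mul_nonneg (hχ1 n x).1 (Real.sqrt_nonneg _)) fun x => ?_
    have h1 : √(1 - (c n * Y x) ^ 2) ^ 2 = 1 - (c n * Y x) ^ 2 :=
      Real.sq_sqrt (by linarith [hcY n x])
    calc _ = χ n x ^ 2 * ((c n * Y x) ^ 2 + √(1 - (c n * Y x) ^ 2) ^ 2) := by ring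
      _ = χ n x ^ 2 := by rw [h1]; ring
      _ ≤ 1 := pow_le_one₀ (hχ1 n x).1 (hχ1 n x).2

lemma hasDerivAt_integral_Iic {g : ℝ → ℝ} (hg : Continuous g) (hgi : Integrable g) (x : ℝ) :
    HasDerivAt (fun x => ∫ t in Iic x, g t) (g x) x := by
  have h1 : (fun x => ∫ t in Iic x, g t) =
      fun x => (∫ t in Iic (0 : ℝ), g t) + ∫ t in (0)..x, g t := by
    ext y
    rw [← intervalIntegral.integral_Iic_sub_Iic hgi.integrableOn hgi.integrableOn]
    ring
  rw [h1]
  exact (intervalIntegral.integral_hasDerivAt_right (hg.intervalIntegrable _ _)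
    (hg.stronglyMeasurableAtFilter _ _) hg.continuousAt).const_add _

/-- Testing the perimeter with the field `(Y, ± √(1 - Y²))`, `Y` absolutely continuous. -/
lemma PlanarPerimeterLE.profile_le {S : Set (ℝ × ℝ)} {P : ℝ} (hS : MeasurableSet S)
    (hP : PlanarPerimeterLE S P) (hSfin : volume S ≠ ⊤)
    {g : ℝ → ℝ} (hg : Integrable g) (hgS : IntegrableOn (fun p : ℝ × ℝ => g p.1) S)
    (hgm : Measurable g) {a : ℝ} (hY1 : ∀ x, |a + ∫ t in Iic x, g t| ≤ 1) :
    (∫ p in S, g p.1) + 2 * ∫ x in shadow S, √(1 - (a + ∫ t in Iic x, g t) ^ 2) ≤ P := by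
  have hsh : volume (shadow S) ≠ ⊤ := by
    refine ((hP.volume_shadow_le hS fun R => ?_).trans_lt ENNReal.ofReal_lt_top).ne
    exact (measure_mono inter_subset_left).trans_lt hSfin.lt_top
  let m : Measure ℝ := (volume.restrict S).map Prod.fst
  have hm : ∀ f : ℝ → ℝ, Measurable f → Integrable f m → IntegrableOn (fun p : ℝ × ℝ => f p.1) S :=
    fun f hf h => (integrable_map_measure hf.aestronglyMeasurable measurable_fst.aemeasurable).1 h
  have : IsFiniteMeasure m := by
    have : IsFiniteMeasure ((volume : Measure (ℝ × ℝ)).restrict S) := ⟨by simpa using hSfin.lt_top⟩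
    infer_instance
  have hgm' : Integrable g m :=
    (integrable_map_measure hgm.aestronglyMeasurable measurable_fst.aemeasurable).2 hgS
  have happ : ∀ n : ℕ, ∃ f : ℝ → ℝ, HasCompactSupport f ∧ Continuous f ∧
      ∫ x, ‖g x - f x‖ ≤ ((n : ℝ) + 1)⁻¹ ∧ ∫ x, ‖g x - f x‖ ∂m ≤ ((n : ℝ) + 1)⁻¹ := by
    intro n
    have hreg : IsFiniteMeasureOnCompacts ((volume : Measure ℝ) + m) :=
      ⟨fun K hK => by simp [hK.measure_lt_top]⟩
    have := isLocallyFiniteMeasure_of_isFiniteMeasureOnCompacts (μ := (volume : Measure ℝ) + m)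
    have hgs : Integrable g (volume + m) := hg.add_measure hgm'
    obtain ⟨f, hfc, h1, h2, h3⟩ := hgs.exists_hasCompactSupport_integral_sub_le
      (by positivity : (0 : ℝ) < ((n : ℝ) + 1)⁻¹)
    have hi := (hgs.sub h3).norm
    have hle := integral_add_measure hi.left_of_add_measure hi.right_of_add_measure
    have p1 : 0 ≤ ∫ x, ‖g x - f x‖ := integral_nonneg fun x => norm_nonneg _
    have p2 : 0 ≤ ∫ x, ‖g x - f x‖ ∂m := integral_nonneg fun x => norm_nonneg _
    simp only [Pi.sub_apply] at hle
    exact ⟨f, hfc, h2, by linarith, by linarith⟩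
  choose f hfc hf h1 h2 using happ
  have hfi : ∀ n, Integrable (f n) := fun n => (hf n).integrable_of_hasCompactSupport (hfc n)
  have hfm : ∀ n, Integrable (f n) m := fun n => (hf n).integrable_of_hasCompactSupport (hfc n)
  have hfS : ∀ n, IntegrableOn (fun p : ℝ × ℝ => f n p.1) S :=
    fun n => hm _ (hf n).measurable (hfm n)
  let ε : ℕ → ℝ := fun n => ((n : ℝ) + 1)⁻¹
  have hε : ∀ n, 0 < 1 + ε n := fun n => by positivity
  have hεl : Tendsto ε atTop (𝓝 0) := by
    simpa [ε] using tendsto_one_div_add_atTop_nhds_zero_nat (𝕜 := ℝ)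
  have hYl : ∀ n x, |(∫ t in Iic x, f n t) - ∫ t in Iic x, g t| ≤ ε n := by
    intro n x
    rw [← integral_sub (hfi n).integrableOn hg.integrableOn, ← Real.norm_eq_abs]
    refine (norm_integral_le_integral_norm _).trans ?_
    refine (setIntegral_le_integral ((hfi n).sub hg).norm
      (Eventually.of_forall fun x => norm_nonneg _)).trans ?_
    exact (integral_congr_ae (Eventually.of_forall fun x => norm_sub_rev _ _)).trans_le (h1 n)
  have hYl' : ∀ x, Tendsto (fun n => ∫ t in Iic x, f n t) atTop (𝓝 (∫ t in Iic x, g t)) := by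
    intro x
    rw [tendsto_iff_norm_sub_tendsto_zero]
    exact squeeze_zero (fun n => norm_nonneg _) (fun n => hYl n x) hεl
  have hSl : Tendsto (fun n => ∫ p in S, f n p.1) atTop (𝓝 (∫ p in S, g p.1)) := by
    rw [tendsto_iff_norm_sub_tendsto_zero]
    refine squeeze_zero (fun n => norm_nonneg _) (fun n => ?_) hεl
    rw [← integral_sub (hfS n) hgS]
    refine (norm_integral_le_integral_norm _).trans ?_
    have := h2 n
    have hmm : AEStronglyMeasurable (fun x => ‖g x - f n x‖) m :=
      ((hgm.sub (hf n).measurable).norm).aestronglyMeasurable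
    rw [integral_map measurable_fst.aemeasurable hmm] at this
    exact (integral_congr_ae (Eventually.of_forall fun x => norm_sub_rev _ _)).trans_le this
  let Y : ℕ → ℝ → ℝ := fun n x => (a + ∫ t in Iic x, f n t) / (1 + ε n)
  have hYd : ∀ n x, HasDerivAt (Y n) (f n x / (1 + ε n)) x := fun n x =>
    ((hasDerivAt_integral_Iic (hf n) (hfi n) x).const_add _).div_const _
  have hYd' : ∀ n, deriv (Y n) = fun x => f n x / (1 + ε n) := fun n =>
    funext fun x => (hYd n x).deriv
  have hYC : ∀ n, ContDiff ℝ 1 (Y n) := fun n => by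
    rw [contDiff_one_iff_deriv, hYd']
    exact ⟨fun x => (hYd n x).differentiableAt, (hf n).div_const _⟩
  have hle : ∀ n, (∫ p in S, f n p.1) / (1 + ε n) + 2 * ∫ x in shadow S, √(1 - Y n x ^ 2) ≤ P := by
    intro n
    have := hP.profile_le_of_contDiff hS hSfin hsh (hYC n) (fun x => ?_) ?_
    · simp only [hYd'] at this
      rwa [integral_div] at this
    · rw [abs_div, abs_of_pos (hε n), div_le_one (hε n)]
      calc |a + ∫ t in Iic x, f n t|
          = |(a + ∫ t in Iic x, g t) + ((∫ t in Iic x, f n t) - ∫ t in Iic x, g t)| := by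
            congr 1
            ring
        _ ≤ 1 + ε n := (abs_add_le _ _).trans (add_le_add (hY1 x) (hYl n x))
    · simp only [hYd']
      exact (hfS n).div_const _
  refine le_of_tendsto' (x := atTop) (Tendsto.add ?_ (Tendsto.const_mul 2 ?_)) hle
  · have := Tendsto.div hSl (hεl.const_add 1) (by simp)
    rw [add_zero, div_one] at this
    exact this
  · refine tendsto_integral_of_dominated_convergence (fun p => 1) ?_ ?_ ?_ ?_
    · intro n
      have := (hYC n).continuous
      exact (by fun_prop : Continuous fun x => √(1 - Y n x ^ 2)).aestronglyMeasurable
    · exact integrableOn_const hsh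
    · refine fun n => Eventually.of_forall fun x => ?_
      rw [Real.norm_of_nonneg (Real.sqrt_nonneg _)]
      exact Real.sqrt_le_one.2 (by linarith [sq_nonneg (Y n x)])
    · refine Eventually.of_forall fun x => ?_
      have h3 := ((((hYl' x).const_add a).div (hεl.const_add 1) (by simp)).pow 2).const_sub 1
      have h4 := (Real.continuous_sqrt.tendsto _).comp h3
      simpa [Function.comp_def, Y] using h4

/-- The distribution function of the length of a subset of the line. -/
noncomputable def cumLength (I : Set ℝ) (x : ℝ) : ℝ := volume.real (I ∩ Iic x)

lemma cumLength_nonneg (I : Set ℝ) (x : ℝ) : 0 ≤ cumLength I x := measureReal_nonneg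

lemma cumLength_mono {I : Set ℝ} (hI : volume I ≠ ⊤) : Monotone (cumLength I) := fun _ _ h =>
  measureReal_mono (inter_subset_inter_right _ (Iic_subset_Iic.2 h))
    (measure_ne_top_of_subset inter_subset_left hI)

lemma cumLength_le {I : Set ℝ} (hI : volume I ≠ ⊤) (x : ℝ) : cumLength I x ≤ volume.real I :=
  measureReal_mono inter_subset_left hI

lemma integrable_indicator_const {I : Set ℝ} (hIm : MeasurableSet I) (hI : volume I ≠ ⊤) (c : ℝ) :
    Integrable (I.indicator fun _ => c) :=
  (integrable_indicator_iff hIm).2 (integrableOn_const hI)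

lemma setIntegral_Iic_indicator_const {I : Set ℝ} (hIm : MeasurableSet I) (c x : ℝ) :
    ∫ t in Iic x, I.indicator (fun _ => c) t = c * cumLength I x := by
  rw [setIntegral_indicator hIm, setIntegral_const, inter_comm, cumLength, smul_eq_mul, mul_comm]

lemma continuous_cumLength {I : Set ℝ} (hIm : MeasurableSet I) (hI : volume I ≠ ⊤) :
    Continuous (cumLength I) := by
  have hi := integrable_indicator_const hIm hI 1
  have h1 : cumLength I = fun x => (∫ t in Iic (0 : ℝ), I.indicator (fun _ => (1 : ℝ)) t) +
      ∫ t in (0)..x, I.indicator (fun _ => (1 : ℝ)) t := by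
    ext y
    rw [← intervalIntegral.integral_Iic_sub_Iic hi.integrableOn hi.integrableOn,
      setIntegral_Iic_indicator_const hIm, setIntegral_Iic_indicator_const hIm]
    ring
  rw [h1]
  exact continuous_const.add (intervalIntegral.continuous_primitive
    (fun a b => hi.intervalIntegrable) 0)

lemma tendsto_cumLength_atTop {I : Set ℝ} (hI : volume I ≠ ⊤) :
    Tendsto (cumLength I) atTop (𝓝 (volume.real I)) := by
  have h := tendsto_measure_Iic_atTop (volume.restrict I)
  rw [Measure.restrict_apply_univ] at h
  have h2 := (ENNReal.tendsto_toReal hI).comp h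
  refine h2.congr fun x => ?_
  rw [Function.comp_apply, Measure.restrict_apply measurableSet_Iic, inter_comm]
  rfl

lemma tendsto_cumLength_atBot {I : Set ℝ} (hI : volume I ≠ ⊤) :
    Tendsto (cumLength I) atBot (𝓝 0) := by
  have : IsFiniteMeasure ((volume : Measure ℝ).restrict I) := ⟨by simpa using hI.lt_top⟩
  have h := tendsto_measure_iInter_atBot (μ := volume.restrict I)
    (fun x : ℝ => measurableSet_Iic.nullMeasurableSet) monotone_Iic ⟨0, measure_ne_top _ _⟩
  have h0 : ⋂ x : ℝ, Iic x = ∅ := iInter_Iic_eq_empty_iff.2 (by simp [not_bddBelow_univ])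
  rw [h0, measure_empty] at h
  have h2 := (ENNReal.tendsto_toReal ENNReal.zero_ne_top).comp h
  refine h2.congr fun x => ?_
  rw [Function.comp_apply, Function.comp_apply, Measure.restrict_apply measurableSet_Iic,
    inter_comm]
  rfl

lemma map_cumLength {I : Set ℝ} (hIm : MeasurableSet I) (hI : volume I ≠ ⊤) :
    (volume.restrict I).map (cumLength I) = volume.restrict (Ioc 0 (volume.real I)) := by
  have hc := continuous_cumLength hIm hI
  have : IsFiniteMeasure ((volume : Measure ℝ).restrict I) := ⟨by simpa using hI.lt_top⟩
  refine Measure.ext_of_Iic _ _ fun a => ?_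
  rw [Measure.map_apply hc.measurable measurableSet_Iic,
    Measure.restrict_apply (hc.measurable measurableSet_Iic),
    Measure.restrict_apply measurableSet_Iic]
  have hIoc : Iic a ∩ Ioc 0 (volume.real I) = Ioc 0 (min a (volume.real I)) := by
    ext x
    simp only [mem_inter_iff, mem_Iic, mem_Ioc, le_min_iff]
    tauto
  rw [hIoc, Real.volume_Ioc, sub_zero]
  rcases le_or_gt (volume.real I) a with ha | ha
  · have h1 : cumLength I ⁻¹' Iic a = univ :=
      eq_univ_of_forall fun x => (cumLength_le hI x).trans ha
    rw [h1, univ_inter, min_eq_right ha, ofReal_measureReal hI]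
  · rw [min_eq_left ha.le]
    rcases (cumLength I ⁻¹' Iic a).eq_empty_or_nonempty with h0 | hne
    · rw [h0, empty_inter, measure_empty, eq_comm, ENNReal.ofReal_eq_zero]
      by_contra! hpos
      obtain ⟨x, hx⟩ := ((tendsto_cumLength_atBot hI).eventually (Iic_mem_nhds hpos)).exists
      exact h0.subset hx
    · have hbdd : BddAbove (cumLength I ⁻¹' Iic a) := by
        obtain ⟨x, hx⟩ := ((tendsto_cumLength_atTop hI).eventually (Ioi_mem_nhds ha)).exists
        refine ⟨x, fun y hy => ?_⟩
        by_contra! hxy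
        exact absurd (lt_of_lt_of_le hx (cumLength_mono hI hxy.le)) (not_lt.2 hy)
      have hmem := (isClosed_Iic.preimage hc).csSup_mem hne hbdd
      set z := sSup (cumLength I ⁻¹' Iic a)
      have hIic : cumLength I ⁻¹' Iic a = Iic z := by
        ext x
        exact ⟨fun hx => le_csSup hbdd hx, fun hx => (cumLength_mono hI hx).trans hmem⟩
      have hz : cumLength I z = a := by
        refine le_antisymm hmem ?_
        obtain ⟨x, hx⟩ := ((tendsto_cumLength_atTop hI).eventually (Ioi_mem_nhds ha)).exists
        obtain ⟨w, hw⟩ := mem_range_of_exists_le_of_exists_ge hc ⟨z, hmem⟩ ⟨x, le_of_lt hx⟩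
        have hwz : w ∈ Iic z := hIic ▸ (show w ∈ cumLength I ⁻¹' Iic a from hw.le)
        exact hw ▸ cumLength_mono hI hwz
      rw [hIic, inter_comm, ← hz, cumLength,
        ofReal_measureReal (measure_ne_top_of_subset inter_subset_left hI)]

lemma setIntegral_comp_cumLength {I : Set ℝ} (hIm : MeasurableSet I) (hI : volume I ≠ ⊤)
    {f : ℝ → ℝ} (hf : Continuous f) :
    ∫ x in I, f (cumLength I x) = ∫ t in (0)..(volume.real I), f t := by
  rw [intervalIntegral.integral_of_le measureReal_nonneg, ← map_cumLength hIm hI,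
    integral_map (continuous_cumLength hIm hI).aemeasurable hf.aestronglyMeasurable]

lemma setIntegral_sqrt_cumLength {I : Set ℝ} (hIm : MeasurableSet I) (hI : volume I ≠ ⊤)
    {j : ℝ} (hj : volume.real I = j) (hj0 : 0 < j) :
    ∫ x in I, √(1 - (-1 + 2 / j * cumLength I x) ^ 2) = Real.pi * j / 4 := by
  rw [setIntegral_comp_cumLength hIm hI (f := fun t => √(1 - (-1 + 2 / j * t) ^ 2)) (by fun_prop),
    hj, intervalIntegral.integral_comp_add_mul (fun t => √(1 - t ^ 2)) (by positivity)]
  have h1 : -1 + 2 / j * j = 1 := by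
    field_simp
    norm_num
  rw [h1, mul_zero, add_zero, integral_sqrt_one_sub_sq, smul_eq_mul]
  field_simp
  norm_num

lemma ae_mem_shadow {S : Set (ℝ × ℝ)} (hS : MeasurableSet S) :
    ∀ᵐ p : ℝ × ℝ, p ∈ S → p.1 ∈ shadow S := by
  have hm : MeasurableSet (S ∩ Prod.fst ⁻¹' (shadow S)ᶜ) :=
    hS.inter (measurable_fst (measurableSet_shadow hS).compl)
  have h0 : volume (S ∩ Prod.fst ⁻¹' (shadow S)ᶜ) = 0 := by
    rw [Measure.volume_eq_prod, Measure.measure_prod_null hm]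
    refine Eventually.of_forall fun x => ?_
    by_cases hx : x ∈ shadow S
    · have : Prod.mk x ⁻¹' (S ∩ Prod.fst ⁻¹' (shadow S)ᶜ) = ∅ := by
        ext y
        simp [hx]
      simp only [this, measure_empty, Pi.zero_apply]
    · exact measure_mono_null (preimage_mono inter_subset_left) (not_not.1 hx)
  filter_upwards [compl_mem_ae_iff.2 h0] with p hp hpS
  by_contra hn
  exact hp ⟨hpS, hn⟩

lemma volume_eq_zero_of_shadow {S : Set (ℝ × ℝ)} (hS : MeasurableSet S)
    (h : volume (shadow S) = 0) : volume S = 0 := by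
  rw [Measure.volume_eq_prod, Measure.measure_prod_null hS]
  filter_upwards [compl_mem_ae_iff.2 h] with x hx
  exact not_not.1 hx

lemma PlanarPerimeterLE.volume_shadow_ne_top {S : Set (ℝ × ℝ)} {P : ℝ} (hS : MeasurableSet S)
    (hP : PlanarPerimeterLE S P) (hSfin : volume S ≠ ⊤) : volume (shadow S) ≠ ⊤ := by
  refine ((hP.volume_shadow_le hS fun R => ?_).trans_lt ENNReal.ofReal_lt_top).ne
  exact (measure_mono inter_subset_left).trans_lt hSfin.lt_top

/-- A lower bound of the perimeter in terms of the area and of the length of the shadow. -/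
lemma PlanarPerimeterLE.area_div_add_le {S : Set (ℝ × ℝ)} {P : ℝ} (hS : MeasurableSet S)
    (hP : PlanarPerimeterLE S P) (hSfin : volume S ≠ ⊤) {j : ℝ} (hj : volume.real (shadow S) = j)
    (hj0 : 0 < j) : 2 / j * volume.real S + Real.pi * j / 2 ≤ P := by
  have hI := hP.volume_shadow_ne_top hS hSfin
  have hIm := measurableSet_shadow hS
  let g : ℝ → ℝ := (shadow S).indicator fun _ => 2 / j
  have hgS : ∀ᵐ p : ℝ × ℝ ∂volume.restrict S, 2 / j = g p.1 := by
    rw [ae_restrict_iff' hS]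
    filter_upwards [ae_mem_shadow hS] with p hp hpS
    rw [show g p.1 = _ from indicator_of_mem (hp hpS) _]
  have key := hP.profile_le hS hSfin (g := g) (a := -1) (integrable_indicator_const hIm hI _)
    ((integrableOn_const hSfin).congr hgS) (measurable_const.indicator hIm) fun x => ?_
  · rw [← integral_congr_ae hgS, setIntegral_const] at key
    simp only [g, setIntegral_Iic_indicator_const hIm] at key
    rw [setIntegral_sqrt_cumLength hIm hI hj hj0, smul_eq_mul, mul_comm] at key
    linarith
  · rw [setIntegral_Iic_indicator_const hIm, abs_le]
    have h1 := cumLength_nonneg (shadow S) x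
    have h2 := cumLength_le hI x
    rw [hj] at h2
    have h3 : 2 / j * cumLength (shadow S) x ≤ 2 / j * j := by gcongr
    have h4 : 2 / j * j = 2 := by field_simp
    have h5 : 0 ≤ 2 / j * cumLength (shadow S) x := by positivity
    constructor <;> linarith

lemma PlanarPerimeterLE.shadow_eq_two {S : Set (ℝ × ℝ)} (hS : MeasurableSet S)
    (hP : PlanarPerimeterLE S (2 * Real.pi)) (hSfin : volume S ≠ ⊤)
    (hA : Real.pi ≤ volume.real S) : volume.real (shadow S) = 2 := by
  have hj0 : 0 < volume.real (shadow S) := by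
    refine measureReal_nonneg.lt_of_ne' fun h0 => ?_
    have := volume_eq_zero_of_shadow hS
      ((measureReal_eq_zero_iff (hP.volume_shadow_ne_top hS hSfin)).1 h0)
    rw [measureReal_def, this] at hA
    simp only [ENNReal.toReal_zero] at hA
    linarith [Real.pi_pos]
  have key := hP.area_div_add_le hS hSfin rfl hj0
  set j := volume.real (shadow S)
  have h1 : 2 / j * Real.pi + Real.pi * j / 2 ≤ 2 * Real.pi := by
    refine le_trans ?_ key
    gcongr
  have h2 : 2 / j * Real.pi + Real.pi * j / 2 - 2 * Real.pi = Real.pi / (2 * j) * (j - 2) ^ 2 := by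
    field_simp
    ring
  have h3 : 0 < Real.pi / (2 * j) := by have := Real.pi_pos; positivity
  have h4 : (j - 2) ^ 2 ≤ 0 := by
    by_contra! h
    linarith [mul_pos h3 h]
  have h5 : j - 2 = 0 := pow_eq_zero_iff two_ne_zero |>.1 (le_antisymm h4 (sq_nonneg _))
  linarith

lemma fderiv_comp_swap {u : ℝ × ℝ → ℝ} (hu : ContDiff ℝ 1 u) (p w : ℝ × ℝ) :
    fderiv ℝ (fun q => u q.swap) p w = fderiv ℝ u p.swap w.swap := by
  have h1 : HasFDerivAt (Prod.swap : ℝ × ℝ → ℝ × ℝ)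
      (ContinuousLinearEquiv.prodComm ℝ ℝ ℝ : ℝ × ℝ →L[ℝ] ℝ × ℝ) p :=
    (ContinuousLinearEquiv.prodComm ℝ ℝ ℝ).hasFDerivAt
  have h2 := ((hu.differentiable one_ne_zero) p.swap).hasFDerivAt.comp p h1
  have h3 : fderiv ℝ (fun q => u q.swap) p = _ := h2.fderiv
  rw [h3]
  rfl

lemma PlanarPerimeterLE.swap {S : Set (ℝ × ℝ)} {P : ℝ} (hP : PlanarPerimeterLE S P) :
    PlanarPerimeterLE (Prod.swap ⁻¹' S) P := by
  intro u v hu hv huc hvc huv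
  have hsw : ContDiff ℝ 1 (Prod.swap : ℝ × ℝ → ℝ × ℝ) := contDiff_snd.prodMk contDiff_fst
  have key := hP (fun q => v q.swap) (fun q => u q.swap) (hv.comp hsw) (hu.comp hsw)
    (hvc.comp_homeomorph (Homeomorph.prodComm ℝ ℝ)) (huc.comp_homeomorph (Homeomorph.prodComm ℝ ℝ))
    fun p => by rw [add_comm]; exact huv _
  have hmp : MeasurePreserving (Prod.swap : ℝ × ℝ → ℝ × ℝ) volume volume :=
    Measure.measurePreserving_swap
  have he : MeasurableEmbedding (Prod.swap : ℝ × ℝ → ℝ × ℝ) :=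
    MeasurableEquiv.prodComm.measurableEmbedding
  rw [← hmp.setIntegral_preimage_emb he] at key
  convert key using 3 with p
  rw [fderiv_comp_swap hv, fderiv_comp_swap hu, Prod.swap_swap, add_comm]
  rfl

lemma PlanarPerimeterLE.volume_lt_pi {S : Set (ℝ × ℝ)} (hS : MeasurableSet S)
    (hP : PlanarPerimeterLE S (2 * Real.pi))
    (hreg : ∀ p ∈ S, |p.1| ≤ 1 ∧ p.1 ^ 2 ≤ p.2 * (1 - p.1 ^ 2)) :
    volume S < ENNReal.ofReal Real.pi := by
  set T : Set (ℝ × ℝ) := Prod.swap ⁻¹' S with hTdef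
  have hT : MeasurableSet T := measurable_swap hS
  have hPT : PlanarPerimeterLE T (2 * Real.pi) := hP.swap
  have hmp : MeasurePreserving (Prod.swap : ℝ × ℝ → ℝ × ℝ) volume volume :=
    Measure.measurePreserving_swap
  have hvol : volume T = volume S := hmp.measure_preimage hS.nullMeasurableSet
  have hT1 : ∀ p ∈ T, p.2 ∈ Icc (-1 : ℝ) 1 := fun p hp => abs_le.1 (hreg _ hp).1
  have hJ : volume (shadow T) ≠ ⊤ := by
    refine ((hPT.volume_shadow_le hT fun R => ?_).trans_lt ENNReal.ofReal_lt_top).ne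
    have : T ∩ Icc (-R) R ×ˢ univ ⊆ Icc (-R) R ×ˢ Icc (-1) 1 := fun p hp => ⟨hp.2.1, hT1 p hp.1⟩
    refine (measure_mono this).trans_lt ?_
    rw [Measure.volume_eq_prod, Measure.prod_prod, Real.volume_Icc, Real.volume_Icc]
    exact ENNReal.mul_lt_top ENNReal.ofReal_lt_top ENNReal.ofReal_lt_top
  have hTfin : volume T ≠ ⊤ := by
    have h1 : volume T ≤ volume (shadow T ×ˢ Icc (-1 : ℝ) 1) := by
      refine measure_mono_ae ?_
      filter_upwards [ae_mem_shadow hT] with p hp hpT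
      exact ⟨hp hpT, hT1 p hpT⟩
    refine (h1.trans_lt ?_).ne
    rw [Measure.volume_eq_prod, Measure.prod_prod, Real.volume_Icc]
    exact ENNReal.mul_lt_top hJ.lt_top ENNReal.ofReal_lt_top
  have hSfin : volume S ≠ ⊤ := hvol ▸ hTfin
  by_contra! hA
  have hAS : Real.pi ≤ volume.real S := (ENNReal.ofReal_le_iff_le_toReal hSfin).1 hA
  have hAT : Real.pi ≤ volume.real T := by rwa [measureReal_def, hvol]
  have hI2 := hP.shadow_eq_two hS hSfin hAS
  have hJ2 := hPT.shadow_eq_two hT hTfin hAT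
  have hJm := measurableSet_shadow hT
  have hpos : ∀ h : ℝ, 0 ≤ h → volume (shadow T ∩ Ioi h) ≠ 0 := by
    intro h hh h0
    have h1 : ∀ᵐ p : ℝ × ℝ, p ∈ S → p.2 ≤ h := by
      have h2 : ∀ᵐ p : ℝ × ℝ, p.1 ∉ shadow T ∩ Ioi h :=
        Measure.quasiMeasurePreserving_fst.ae (compl_mem_ae_iff.2 h0)
      have h3 : ∀ᵐ p : ℝ × ℝ, p ∈ T → p.1 ≤ h := by
        filter_upwards [ae_mem_shadow hT, h2] with p hp1 hp2 hpT
        by_contra! hlt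
        exact hp2 ⟨hp1 hpT, hlt⟩
      filter_upwards [hmp.quasiMeasurePreserving.ae h3] with p hp hpS
      exact hp hpS
    rw [Measure.volume_eq_prod] at h1
    let s : ℝ := 1 - 1 / (2 * (1 + h))
    have hsub : shadow S ≤ᵐ[volume] Icc (-1) s := by
      filter_upwards [Measure.ae_ae_of_ae_prod h1] with x hx hxI
      obtain ⟨y, hyS, hyh⟩ : ∃ y, (x, y) ∈ S ∧ y ≤ h := by
        by_contra! hno
        refine hxI (measure_mono_null (fun y hy => ?_) hx)
        exact fun hcon => absurd (hcon hy) (not_le.2 (hno y hy))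
      obtain ⟨hx1, hx2⟩ := hreg _ hyS
      simp only at hx1 hx2
      have hx1' := abs_le.1 hx1
      refine ⟨hx1'.1, ?_⟩
      have hx3 : x ^ 2 ≤ h * (1 - x ^ 2) := by
        have : x ^ 2 ≤ 1 := (sq_le_one_iff_abs_le_one _).2 hx1
        exact hx2.trans (mul_le_mul_of_nonneg_right hyh (by linarith))
      have hh' : 0 < 1 + h := by linarith
      have hx4 : x ^ 2 ≤ h / (1 + h) := by
        rw [le_div_iff₀ hh']
        linarith
      have e : 2 * s = 1 + h / (1 + h) := by
        simp only [s]
        field_simp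
        ring
      nlinarith [sq_nonneg (x - 1)]
    have hle := measure_mono_ae hsub
    rw [Real.volume_Icc, ← ENNReal.toReal_le_toReal (hP.volume_shadow_ne_top hS hSfin)
      ENNReal.ofReal_ne_top] at hle
    rw [measureReal_def] at hI2
    have hs : s < 1 := by
      have : 0 < 1 / (2 * (1 + h)) := by positivity
      simp only [s]
      linarith
    have hs0 : 0 ≤ s - -1 := by
      have : 1 / (2 * (1 + h)) ≤ 1 := by
        rw [div_le_one (by positivity)]
        linarith
      simp only [s]
      linarith
    rw [hI2, ENNReal.toReal_ofReal hs0] at hle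
    linarith
  obtain ⟨n, hn0, hn⟩ : ∃ n : ℝ, 0 ≤ n ∧ 3 / 2 ≤ cumLength (shadow T) n := by
    have := tendsto_cumLength_atTop hJ
    rw [hJ2] at this
    exact ((eventually_ge_atTop 0).and (this.eventually (Ici_mem_nhds (by norm_num)))).exists
  set J := shadow T with hJdef
  let Z : Set ℝ := Ioc n (n + 3) \ J
  have hZm : MeasurableSet Z := measurableSet_Ioc.diff hJm
  have hIoc : volume (Ioc n (n + 3)) = ENNReal.ofReal 3 := by
    rw [Real.volume_Ioc]
    congr 1
    ring
  have hZ : volume Z ≠ ⊤ :=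
    measure_ne_top_of_subset sdiff_subset (by rw [hIoc]; exact ENNReal.ofReal_ne_top)
  have hZ3 : volume.real Z ≤ 3 := by
    have : volume.real Z ≤ volume.real (Ioc n (n + 3)) :=
      measureReal_mono sdiff_subset (by rw [hIoc]; exact ENNReal.ofReal_ne_top)
    rwa [measureReal_def, measureReal_def, hIoc, ENNReal.toReal_ofReal (by norm_num)] at this
  have hZ0 : 0 < volume.real Z := by
    have h1 : volume.real (Ioc n (n + 3)) ≤ volume.real Z + volume.real J := by
      refine (measureReal_mono (s₂ := Z ∪ J) (fun x hx => ?_) ?_).trans (measureReal_union_le _ _)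
      · by_cases hxJ : x ∈ J
        · exact Or.inr hxJ
        · exact Or.inl ⟨hx, hxJ⟩
      · exact measure_union_ne_top hZ hJ
    rw [hJ2, measureReal_def, hIoc, ENNReal.toReal_ofReal (by norm_num)] at h1
    linarith
  let t := cumLength J
  let z := cumLength Z
  have hz0 : ∀ x, 0 ≤ z x := cumLength_nonneg Z
  have hz3 : ∀ x, z x ≤ 3 := fun x => (cumLength_le hZ x).trans hZ3
  have ht0 : ∀ x, 0 ≤ t x := cumLength_nonneg J
  have ht2 : ∀ x, t x ≤ 2 := fun x => hJ2 ▸ cumLength_le hJ x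
  have hzn : ∀ x ≤ n, z x = 0 := fun x hx => by
    have : Z ∩ Iic x = ∅ := by
      ext y
      simp only [mem_inter_iff, mem_Iic, mem_empty_iff_false, iff_false, not_and, not_le]
      exact fun hy => hx.trans_lt hy.1.1
    simp [z, cumLength, this]
  have htn : ∀ x, n ≤ x → 3 / 2 ≤ t x := fun x hx => hn.trans (cumLength_mono hJ hx)
  have hzn3 : ∀ x, n + 3 ≤ x → 0 < z x := fun x hx => by
    have : Z ∩ Iic x = Z := inter_eq_left.2 fun y hy => hy.1.2.trans hx
    simpa [z, cumLength, this] using hZ0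
  let Y : ℝ → ℝ := fun x => -1 + (t x - 1 / 4 * z x)
  have hYle : ∀ x, Y x ^ 2 ≤ (-1 + t x) ^ 2 := fun x => by
    rcases le_total x n with hx | hx
    · simp [Y, hzn x hx]
    · have h1 := htn x hx
      have h2 := hz0 x
      have h3 := hz3 x
      rw [sq_le_sq, abs_of_nonneg (show 0 ≤ -1 + t x by linarith), abs_le]
      constructor <;> simp only [Y] <;> linarith
  have hYlt : ∀ x, n + 3 ≤ x → Y x ^ 2 < (-1 + t x) ^ 2 := fun x hx => by
    have h1 := htn x (by linarith)
    have h2 := hzn3 x hx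
    have h3 := hz3 x
    rw [sq_lt_sq, abs_of_nonneg (show 0 ≤ -1 + t x by linarith), abs_lt]
    constructor <;> simp only [Y] <;> linarith
  have ht1 : ∀ x, (-1 + t x) ^ 2 ≤ 1 := fun x => by
    rw [sq_le_one_iff_abs_le_one, abs_le]
    constructor <;> linarith [ht0 x, ht2 x]
  let g : ℝ → ℝ := fun x => J.indicator (fun _ => 1) x - Z.indicator (fun _ => 1 / 4) x
  have hgi1 := integrable_indicator_const hJm hJ 1
  have hgi2 := integrable_indicator_const hZm hZ (1 / 4)
  have hgY : ∀ x, -1 + ∫ y in Iic x, g y = Y x := fun x => by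
    simp only [g]
    rw [integral_sub hgi1.integrableOn hgi2.integrableOn, setIntegral_Iic_indicator_const hJm,
      setIntegral_Iic_indicator_const hZm, one_mul]
  have hgT : ∀ᵐ p : ℝ × ℝ ∂volume.restrict T, 1 = g p.1 := by
    rw [ae_restrict_iff' hT]
    filter_upwards [ae_mem_shadow hT] with p hp hpT
    have h1 : p.1 ∈ J := hp hpT
    have h2 : p.1 ∉ Z := fun h => h.2 h1
    simp [g, h1, h2]
  have key := hPT.profile_le hT hTfin (g := g) (a := -1) (hgi1.sub hgi2)
    ((integrableOn_const hTfin).congr hgT)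
    ((measurable_const.indicator hJm).sub (measurable_const.indicator hZm)) fun x => by
      rw [hgY, ← sq_le_one_iff_abs_le_one]
      exact (hYle x).trans (ht1 x)
  rw [← integral_congr_ae hgT, setIntegral_const, smul_eq_mul, mul_one] at key
  simp only [hgY] at key
  have hsemi := setIntegral_sqrt_cumLength hJm hJ hJ2 two_pos
  have htc : Continuous t := continuous_cumLength hJm hJ
  have hzc : Continuous z := continuous_cumLength hZm hZ
  have hsqrt_int : ∀ f : ℝ → ℝ, Continuous f → IntegrableOn (fun x => √(1 - f x ^ 2)) J := by
    intro f hf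
    have h1 : IntegrableOn (fun _ => (1 : ℝ)) J := integrableOn_const hJ
    refine Integrable.mono' h1
      (by fun_prop : Continuous fun x => √(1 - f x ^ 2)).aestronglyMeasurable
      (Eventually.of_forall fun x => ?_)
    rw [Real.norm_of_nonneg (Real.sqrt_nonneg _)]
    exact Real.sqrt_le_one.2 (by linarith [sq_nonneg (f x)])
  have hlt : ∫ x in J, √(1 - (-1 + t x) ^ 2) < ∫ x in J, √(1 - Y x ^ 2) := by
    have hi := (hsqrt_int Y (by fun_prop)).sub (hsqrt_int (fun x => -1 + t x) (by fun_prop))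
    have hnn : ∀ x, √(1 - (-1 + t x) ^ 2) ≤ √(1 - Y x ^ 2) := fun x =>
      Real.sqrt_le_sqrt (by linarith [hYle x])
    have hpos' := (integral_pos_iff_support_of_nonneg_ae
      (Eventually.of_forall fun x => sub_nonneg.2 (hnn x)) hi).2 ?_
    · rw [integral_sub (hsqrt_int Y (by fun_prop)) (hsqrt_int (fun x => -1 + t x) (by fun_prop))] at hpos'
      linarith
    · refine pos_iff_ne_zero.2 fun h0 => hpos (n + 3) (by linarith) ?_
      rw [inter_comm, ← Measure.restrict_apply measurableSet_Ioi]
      refine measure_mono_null (fun x hx => ?_) h0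
      have := Real.sqrt_lt_sqrt (by linarith [ht1 x]) (sub_lt_sub_left (hYlt x (le_of_lt hx)) 1)
      exact (sub_pos.2 this).ne'
  have e : ∫ x in J, √(1 - (-1 + t x) ^ 2) = Real.pi / 2 := by
    rw [div_self two_ne_zero] at hsemi
    simp only [one_mul] at hsemi
    rw [hsemi]
    ring
  linarith

/-- The identification of `EuclideanSpace ℝ (Fin 2)` with `ℝ × ℝ`. -/
noncomputable def planeEquiv : EuclideanSpace ℝ (Fin 2) ≃L[ℝ] ℝ × ℝ :=
  (EuclideanSpace.equiv (Fin 2) ℝ).trans (ContinuousLinearEquiv.finTwoArrow ℝ ℝ)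

lemma planeEquiv_apply (p : EuclideanSpace ℝ (Fin 2)) : planeEquiv p = (p 0, p 1) := rfl

lemma planeEquiv_symm_zero (q : ℝ × ℝ) : planeEquiv.symm q 0 = q.1 :=
  congr_arg Prod.fst (planeEquiv.apply_symm_apply q)

lemma planeEquiv_symm_one (q : ℝ × ℝ) : planeEquiv.symm q 1 = q.2 :=
  congr_arg Prod.snd (planeEquiv.apply_symm_apply q)

lemma measurePreserving_planeEquiv : MeasurePreserving planeEquiv volume volume :=
  (volume_preserving_finTwoArrow ℝ).comp (PiLp.volume_preserving_ofLp (Fin 2))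

lemma measurePreserving_planeEquiv_symm : MeasurePreserving planeEquiv.symm volume volume :=
  measurePreserving_planeEquiv.symm planeEquiv.toHomeomorph.toMeasurableEquiv

lemma vecDiv_eq {φ : EuclideanSpace ℝ (Fin 2) → EuclideanSpace ℝ (Fin 2)} (hφ : ContDiff ℝ 1 φ)
    (q : ℝ × ℝ) : vecDiv φ (planeEquiv.symm q) =
      fderiv ℝ (fun q => φ (planeEquiv.symm q) 0) q (1, 0) +
        fderiv ℝ (fun q => φ (planeEquiv.symm q) 1) q (0, 1) := by
  have h (i : Fin 2) (w : ℝ × ℝ) : fderiv ℝ (fun q => φ (planeEquiv.symm q) i) q w =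
      fderiv ℝ φ (planeEquiv.symm q) (planeEquiv.symm w) i := by
    have h1 := ((hφ.differentiable one_ne_zero) (planeEquiv.symm q)).hasFDerivAt.comp q
      (planeEquiv.symm : ℝ × ℝ →L[ℝ] EuclideanSpace ℝ (Fin 2)).hasFDerivAt
    have h2 := (EuclideanSpace.proj (𝕜 := ℝ) i).hasFDerivAt.comp q h1
    have h3 : fderiv ℝ (fun q => φ (planeEquiv.symm q) i) q = _ := h2.fderiv
    rw [h3]
    rfl
  have e0 : planeEquiv.symm (1, 0) = EuclideanSpace.single 0 1 := by
    ext i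
    fin_cases i
    · simp [planeEquiv_symm_zero]
    · simp [planeEquiv_symm_one]
  have e1 : planeEquiv.symm (0, 1) = EuclideanSpace.single 1 1 := by
    ext i
    fin_cases i
    · simp [planeEquiv_symm_zero]
    · simp [planeEquiv_symm_one]
  rw [h, h, e0, e1, vecDiv, Fin.sum_univ_two]

lemma setIntegral_vecDiv {φ : EuclideanSpace ℝ (Fin 2) → EuclideanSpace ℝ (Fin 2)}
    (hφ : ContDiff ℝ 1 φ) (E : Set (EuclideanSpace ℝ (Fin 2))) :
    ∫ p in E, vecDiv φ p = ∫ q in planeEquiv.symm ⁻¹' E,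
      (fderiv ℝ (fun q => φ (planeEquiv.symm q) 0) q (1, 0) +
        fderiv ℝ (fun q => φ (planeEquiv.symm q) 1) q (0, 1)) := by
  rw [← measurePreserving_planeEquiv_symm.setIntegral_preimage_emb
    planeEquiv.symm.toHomeomorph.measurableEmbedding]
  simp only [vecDiv_eq hφ]

lemma ofReal_integral_le_per {E : Set (EuclideanSpace ℝ (Fin 2))} {u v : ℝ × ℝ → ℝ}
    (hu : ContDiff ℝ 1 u) (hv : ContDiff ℝ 1 v) (huc : HasCompactSupport u)
    (hvc : HasCompactSupport v) (huv : ∀ p, u p ^ 2 + v p ^ 2 ≤ 1) :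
    ENNReal.ofReal (∫ q in planeEquiv.symm ⁻¹' E, (fderiv ℝ u q (1, 0) + fderiv ℝ v q (0, 1))) ≤
      per E := by
  let φ : EuclideanSpace ℝ (Fin 2) → EuclideanSpace ℝ (Fin 2) := fun p =>
    planeEquiv.symm (u (planeEquiv p), v (planeEquiv p))
  have hφ : ContDiff ℝ 1 φ := planeEquiv.symm.contDiff.comp
    ((hu.comp planeEquiv.contDiff).prodMk (hv.comp planeEquiv.contDiff))
  have hφc : HasCompactSupport φ := by
    have h1 : HasCompactSupport fun p => u (planeEquiv p) :=
      huc.comp_homeomorph planeEquiv.toHomeomorph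
    have h2 : HasCompactSupport fun p => v (planeEquiv p) :=
      hvc.comp_homeomorph planeEquiv.toHomeomorph
    refine HasCompactSupport.of_support_subset_isCompact (h1.isCompact.union h2.isCompact) ?_
    intro p hp
    by_contra hn
    rw [mem_union, not_or] at hn
    refine hp ?_
    simp only [φ, image_eq_zero_of_notMem_tsupport hn.1, image_eq_zero_of_notMem_tsupport hn.2]
    exact map_zero planeEquiv.symm
  have hφ1 : ∀ p, ‖φ p‖ ≤ 1 := fun p => by
    rw [← sq_le_one_iff₀ (norm_nonneg _), EuclideanSpace.norm_sq_eq, Fin.sum_univ_two]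
    simp only [φ, planeEquiv_symm_zero, planeEquiv_symm_one, Real.norm_eq_abs, sq_abs]
    exact huv _
  refine le_trans (le_of_eq ?_) (le_iSup (fun φ : {φ : EuclideanSpace ℝ (Fin 2) →
    EuclideanSpace ℝ (Fin 2) // ContDiff ℝ 1 φ ∧ HasCompactSupport φ ∧ tsupport φ ⊆ univ ∧
      ∀ x, ‖φ x‖ ≤ 1} => ENNReal.ofReal (∫ x in E, vecDiv φ.1 x))
    ⟨φ, hφ, hφc, subset_univ _, hφ1⟩)
  rw [setIntegral_vecDiv hφ]
  simp only [φ, planeEquiv_symm_zero, planeEquiv_symm_one, ContinuousLinearEquiv.apply_symm_apply]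

lemma per_le_ofReal_iff {E : Set (EuclideanSpace ℝ (Fin 2))} {P : ℝ} (hP : 0 ≤ P) :
    per E ≤ ENNReal.ofReal P ↔ PlanarPerimeterLE (planeEquiv.symm ⁻¹' E) P := by
  constructor
  · intro h u v hu hv huc hvc huv
    exact (ENNReal.ofReal_le_ofReal_iff hP).1
      ((ofReal_integral_le_per hu hv huc hvc huv).trans h)
  · intro h
    refine iSup_le fun φ => ENNReal.ofReal_le_ofReal ?_
    obtain ⟨φ, hφ, hφc, -, hφ1⟩ := φ
    rw [setIntegral_vecDiv hφ]
    have hc (i : Fin 2) : ContDiff ℝ 1 fun q => φ (planeEquiv.symm q) i :=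
      (EuclideanSpace.proj (𝕜 := ℝ) i).contDiff.comp (hφ.comp planeEquiv.symm.contDiff)
    have hs (i : Fin 2) : HasCompactSupport fun q => φ (planeEquiv.symm q) i :=
      (hφc.comp_homeomorph planeEquiv.symm.toHomeomorph).comp_left
        (g := fun p : EuclideanSpace ℝ (Fin 2) => p i) rfl
    refine h _ _ (hc 0) (hc 1) (hs 0) (hs 1) fun q => ?_
    have := (sq_le_one_iff₀ (norm_nonneg _)).2 (hφ1 (planeEquiv.symm q))
    rw [EuclideanSpace.norm_sq_eq, Fin.sum_univ_two] at this
    simpa using this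

lemma volume_preimage_planeEquiv_symm (E : Set (EuclideanSpace ℝ (Fin 2))) :
    volume (planeEquiv.symm ⁻¹' E) = volume E :=
  measurePreserving_planeEquiv_symm.measure_preimage_emb
    planeEquiv.symm.toHomeomorph.measurableEmbedding E

/-- The closed annulus with radii `r` and `R` centred at the origin of `ℝ × ℝ`. -/
def annulus (r R : ℝ) : Set (ℝ × ℝ) :=
  {q | r ^ 2 ≤ q.1 ^ 2 + q.2 ^ 2 ∧ q.1 ^ 2 + q.2 ^ 2 ≤ R ^ 2}

lemma isClosed_annulus (r R : ℝ) : IsClosed (annulus r R) := by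
  have h1 : IsClosed {q : ℝ × ℝ | r ^ 2 ≤ q.1 ^ 2 + q.2 ^ 2} :=
    isClosed_le (by fun_prop) (by fun_prop)
  have h2 : IsClosed {q : ℝ × ℝ | q.1 ^ 2 + q.2 ^ 2 ≤ R ^ 2} :=
    isClosed_le (by fun_prop) (by fun_prop)
  exact h1.inter h2

lemma measurableSet_annulus (r R : ℝ) : MeasurableSet (annulus r R) :=
  (isClosed_annulus r R).measurableSet

lemma annulus_subset {r R : ℝ} (hR : 0 ≤ R) : annulus r R ⊆ Icc (-R) R ×ˢ Icc (-R) R :=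
  fun q hq => ⟨abs_le.1 (abs_le_of_sq_le_sq (by nlinarith [hq.2, sq_nonneg q.2]) hR),
    abs_le.1 (abs_le_of_sq_le_sq (by nlinarith [hq.2, sq_nonneg q.1]) hR)⟩

lemma volume_annulus_ne_top {r R : ℝ} (hR : 0 ≤ R) : volume (annulus r R) ≠ ⊤ :=
  measure_ne_top_of_subset (annulus_subset hR)
    (isCompact_Icc.prod isCompact_Icc).measure_lt_top.ne

lemma setIntegral_annulus_polar {r R : ℝ} (hr : 0 < r) (hrR : r ≤ R) {f : ℝ × ℝ → ℝ}
    (hf : Continuous f) :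
    ∫ q in annulus r R, f q = ∫ t in r..R, ∫ θ in (-Real.pi)..Real.pi,
      t * f (t * Real.cos θ, t * Real.sin θ) := by
  have hF : Continuous fun p : ℝ × ℝ => p.1 * f (p.1 * Real.cos p.2, p.1 * Real.sin p.2) := by
    fun_prop
  have hpi : -Real.pi ≤ Real.pi := by linarith [Real.pi_pos]
  rw [← integral_indicator (measurableSet_annulus r R), ← integral_comp_polarCoord_symm,
    ← integral_indicator polarCoord.open_target.measurableSet]
  have h1 : (polarCoord.target.indicator fun p =>
      p.1 • (annulus r R).indicator f (polarCoord.symm p)) =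
      (Icc r R ×ˢ Ioo (-Real.pi) Real.pi).indicator
        fun p => p.1 * f (p.1 * Real.cos p.2, p.1 * Real.sin p.2) := by
    ext p
    by_cases hp : p ∈ Icc r R ×ˢ Ioo (-Real.pi) Real.pi
    · have h2 : p ∈ polarCoord.target := ⟨hr.trans_le hp.1.1, hp.2⟩
      have h3 : polarCoord.symm p ∈ annulus r R := by
        have e : (p.1 * Real.cos p.2) ^ 2 + (p.1 * Real.sin p.2) ^ 2 = p.1 ^ 2 := by
          linear_combination p.1 ^ 2 * Real.cos_sq_add_sin_sq p.2
        change r ^ 2 ≤ (p.1 * Real.cos p.2) ^ 2 + (p.1 * Real.sin p.2) ^ 2 ∧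
          (p.1 * Real.cos p.2) ^ 2 + (p.1 * Real.sin p.2) ^ 2 ≤ R ^ 2
        rw [e]
        exact ⟨pow_le_pow_left₀ hr.le hp.1.1 2, pow_le_pow_left₀ (hr.le.trans hp.1.1) hp.1.2 2⟩
      rw [indicator_of_mem hp, indicator_of_mem h2, indicator_of_mem h3]
      rfl
    · rw [indicator_of_notMem hp]
      by_cases h2 : p ∈ polarCoord.target
      · have h3 : polarCoord.symm p ∉ annulus r R := by
          intro h3
          have e : (p.1 * Real.cos p.2) ^ 2 + (p.1 * Real.sin p.2) ^ 2 = p.1 ^ 2 := by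
            linear_combination p.1 ^ 2 * Real.cos_sq_add_sin_sq p.2
          change r ^ 2 ≤ (p.1 * Real.cos p.2) ^ 2 + (p.1 * Real.sin p.2) ^ 2 ∧
            (p.1 * Real.cos p.2) ^ 2 + (p.1 * Real.sin p.2) ^ 2 ≤ R ^ 2 at h3
          rw [e] at h3
          have h0 : 0 < p.1 := h2.1
          exact hp ⟨⟨(sq_le_sq₀ hr.le h0.le).1 h3.1, (sq_le_sq₀ h0.le (hr.le.trans hrR)).1 h3.2⟩,
            h2.2⟩
        rw [indicator_of_mem h2, indicator_of_notMem h3, smul_zero]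
      · rw [indicator_of_notMem h2]
  rw [h1, integral_indicator (measurableSet_Icc.prod measurableSet_Ioo), Measure.volume_eq_prod,
    setIntegral_prod, intervalIntegral.integral_of_le hrR, integral_Icc_eq_integral_Ioc]
  · refine integral_congr_ae (Eventually.of_forall fun t => ?_)
    simp only
    rw [intervalIntegral.integral_of_le hpi, integral_Ioc_eq_integral_Ioo]
  · exact (hF.continuousOn.integrableOn_compact (isCompact_Icc.prod isCompact_Icc)).mono_set
      (prod_mono_right Ioo_subset_Icc_self)

/-- The divergence theorem on an annulus. -/
lemma setIntegral_annulus_div {r R : ℝ} (hr : 0 < r) (hrR : r ≤ R) {u v : ℝ × ℝ → ℝ}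
    (hu : ContDiff ℝ 1 u) (hv : ContDiff ℝ 1 v) :
    ∫ q in annulus r R, (fderiv ℝ u q (1, 0) + fderiv ℝ v q (0, 1)) =
      ∫ θ in (-Real.pi)..Real.pi,
        (R * (u (R * Real.cos θ, R * Real.sin θ) * Real.cos θ +
            v (R * Real.cos θ, R * Real.sin θ) * Real.sin θ) -
          r * (u (r * Real.cos θ, r * Real.sin θ) * Real.cos θ +
            v (r * Real.cos θ, r * Real.sin θ) * Real.sin θ)) := by
  let F : ℝ × ℝ → ℝ := fun p => p.1 * (u (p.1 * Real.cos p.2, p.1 * Real.sin p.2) * Real.cos p.2 +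
    v (p.1 * Real.cos p.2, p.1 * Real.sin p.2) * Real.sin p.2)
  let G : ℝ × ℝ → ℝ := fun p => v (p.1 * Real.cos p.2, p.1 * Real.sin p.2) * Real.cos p.2 -
    u (p.1 * Real.cos p.2, p.1 * Real.sin p.2) * Real.sin p.2
  have hcos : ContDiff ℝ 1 Real.cos := Real.contDiff_cos
  have hsin : ContDiff ℝ 1 Real.sin := Real.contDiff_sin
  have hF : ContDiff ℝ 1 F := by fun_prop
  have hG : ContDiff ℝ 1 G := by fun_prop
  have hcu : Continuous fun q => fderiv ℝ u q (1, 0) :=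
    (hu.continuous_fderiv one_ne_zero).clm_apply continuous_const
  have hcv : Continuous fun q => fderiv ℝ v q (0, 1) :=
    (hv.continuous_fderiv one_ne_zero).clm_apply continuous_const
  have hlin (w : ℝ × ℝ → ℝ) (q : ℝ × ℝ) (a b : ℝ) :
      fderiv ℝ w q (a, b) = a * fderiv ℝ w q (1, 0) + b * fderiv ℝ w q (0, 1) := by
    have : ((a, b) : ℝ × ℝ) = a • (1, 0) + b • (0, 1) := by simp
    rw [this, map_add, map_smul, map_smul, smul_eq_mul, smul_eq_mul]
  have hrad (w : ℝ × ℝ → ℝ) (hw : ContDiff ℝ 1 w) (p : ℝ × ℝ) :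
      HasDerivAt (fun t => w (t * Real.cos p.2, t * Real.sin p.2))
        (fderiv ℝ w (p.1 * Real.cos p.2, p.1 * Real.sin p.2) (Real.cos p.2, Real.sin p.2)) p.1 := by
    have h1 : HasDerivAt (fun t : ℝ => (t * Real.cos p.2, t * Real.sin p.2))
        (1 * Real.cos p.2, 1 * Real.sin p.2) p.1 :=
      ((hasDerivAt_id p.1).mul_const _).prodMk ((hasDerivAt_id p.1).mul_const _)
    rw [one_mul, one_mul] at h1
    exact HasFDerivAt.comp_hasDerivAt (f := fun t : ℝ => (t * Real.cos p.2, t * Real.sin p.2)) p.1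
      ((hw.differentiable one_ne_zero) _).hasFDerivAt h1
  have hang (w : ℝ × ℝ → ℝ) (hw : ContDiff ℝ 1 w) (p : ℝ × ℝ) :
      HasDerivAt (fun t => w (p.1 * Real.cos t, p.1 * Real.sin t))
        (fderiv ℝ w (p.1 * Real.cos p.2, p.1 * Real.sin p.2)
          (p.1 * -Real.sin p.2, p.1 * Real.cos p.2)) p.2 := by
    have h1 : HasDerivAt (fun t : ℝ => (p.1 * Real.cos t, p.1 * Real.sin t))
        (p.1 * -Real.sin p.2, p.1 * Real.cos p.2) p.2 :=
      ((Real.hasDerivAt_cos p.2).const_mul _).prodMk ((Real.hasDerivAt_sin p.2).const_mul _)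
    exact HasFDerivAt.comp_hasDerivAt (f := fun t : ℝ => (p.1 * Real.cos t, p.1 * Real.sin t)) p.2
      ((hw.differentiable one_ne_zero) _).hasFDerivAt h1
  have hdiv : ∀ p : ℝ × ℝ, fderiv ℝ F p (1, 0) + fderiv ℝ G p (0, 1) =
      p.1 * (fderiv ℝ u (p.1 * Real.cos p.2, p.1 * Real.sin p.2) (1, 0) +
        fderiv ℝ v (p.1 * Real.cos p.2, p.1 * Real.sin p.2) (0, 1)) := by
    intro p
    rw [fderiv_apply_one_zero_eq (hF.differentiable one_ne_zero p)
      ((hasDerivAt_id p.1).mul (((hrad u hu p).mul_const (Real.cos p.2)).add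
        ((hrad v hv p).mul_const (Real.sin p.2)))),
      fderiv_apply_zero_one_eq (hG.differentiable one_ne_zero p)
      (((hang v hv p).mul (Real.hasDerivAt_cos p.2)).sub
        ((hang u hu p).mul (Real.hasDerivAt_sin p.2)))]
    simp only [hlin u _ (Real.cos _), hlin v _ (Real.cos _), hlin u _ (p.1 * _),
      hlin v _ (p.1 * _), id]
    linear_combination (p.1 * (fderiv ℝ u (p.1 * Real.cos p.2, p.1 * Real.sin p.2) (1, 0) +
        fderiv ℝ v (p.1 * Real.cos p.2, p.1 * Real.sin p.2) (0, 1))) * Real.cos_sq_add_sin_sq p.2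
  rw [setIntegral_annulus_polar hr hrR
    (f := fun q => fderiv ℝ u q (1, 0) + fderiv ℝ v q (0, 1)) (hcu.add hcv)]
  have key := integral2_divergence_prod_of_hasFDerivAt_off_countable F G (fderiv ℝ F) (fderiv ℝ G)
    r (-Real.pi) R Real.pi ∅ countable_empty hF.continuous.continuousOn hG.continuous.continuousOn
    (fun p _ => (hF.differentiable one_ne_zero p).hasFDerivAt)
    (fun p _ => (hG.differentiable one_ne_zero p).hasFDerivAt) ?_
  · simp only [hdiv] at key
    rw [key]
    have hGpi : ∀ t, G (t, Real.pi) = G (t, -Real.pi) := fun t => by simp [G]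
    simp only [hGpi, sub_self, zero_add]
    have hFc := hF.continuous
    rw [← intervalIntegral.integral_sub
      ((by fun_prop : Continuous fun θ => F (R, θ)).intervalIntegrable _ _)
      ((by fun_prop : Continuous fun θ => F (r, θ)).intervalIntegrable _ _)]
  · have c1 : Continuous fun p => fderiv ℝ F p (1, 0) :=
      (hF.continuous_fderiv one_ne_zero).clm_apply continuous_const
    have c2 : Continuous fun p => fderiv ℝ G p (0, 1) :=
      (hG.continuous_fderiv one_ne_zero).clm_apply continuous_const
    exact (c1.add c2).continuousOn.integrableOn_compact (isCompact_uIcc.prod isCompact_uIcc)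

lemma volume_real_annulus {r R : ℝ} (hr : 0 < r) (hrR : r ≤ R) :
    volume.real (annulus r R) = Real.pi * (R ^ 2 - r ^ 2) := by
  have h := setIntegral_annulus_div hr hrR (u := Prod.fst) (v := Prod.snd) contDiff_fst contDiff_snd
  simp only [fderiv_fst, fderiv_snd] at h
  have h1 : ∀ θ : ℝ, R * (R * Real.cos θ * Real.cos θ + R * Real.sin θ * Real.sin θ) -
      r * (r * Real.cos θ * Real.cos θ + r * Real.sin θ * Real.sin θ) = R ^ 2 - r ^ 2 := fun θ => by
    linear_combination (R ^ 2 - r ^ 2) * Real.cos_sq_add_sin_sq θ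
  simp only [h1, intervalIntegral.integral_const, ContinuousLinearMap.coe_fst',
    ContinuousLinearMap.coe_snd', setIntegral_const, smul_eq_mul] at h
  linarith

lemma planarPerimeterLE_annulus {r R : ℝ} (hr : 0 < r) (hrR : r ≤ R) :
    PlanarPerimeterLE (annulus r R) (2 * Real.pi * (R + r)) := by
  intro u v hu hv _ _ huv
  have hc1 := hu.continuous
  have hc2 := hv.continuous
  have hflux (q : ℝ × ℝ) (θ : ℝ) : |u q * Real.cos θ + v q * Real.sin θ| ≤ 1 := by
    rw [← sq_le_one_iff_abs_le_one]
    have := Real.cos_sq_add_sin_sq θ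
    have h0 := huv q
    nlinarith [sq_nonneg (u q * Real.sin θ - v q * Real.cos θ)]
  have hpi : -Real.pi ≤ Real.pi := by linarith [Real.pi_pos]
  rw [setIntegral_annulus_div hr hrR hu hv]
  calc _ ≤ ∫ θ in (-Real.pi)..Real.pi, (R + r) := by
        refine intervalIntegral.integral_mono_on hpi
          (Continuous.intervalIntegrable (by fun_prop) _ _)
          (by simp) fun θ _ => ?_
        have h1 := (abs_le.1 (hflux (R * Real.cos θ, R * Real.sin θ) θ)).2
        have h2 := (abs_le.1 (hflux (r * Real.cos θ, r * Real.sin θ) θ)).1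
        have h3 := mul_le_mul_of_nonneg_left h1 (hr.le.trans hrR)
        have h4 := mul_le_mul_of_nonneg_left h2 hr.le
        linarith
    _ = 2 * Real.pi * (R + r) := by
        rw [intervalIntegral.integral_const, smul_eq_mul]
        ring

/-- A test field realising the perimeter of an annulus. -/
lemma exists_field_annulus {r R : ℝ} (hr : 0 < r) (hrR : r < R) :
    ∃ u v : ℝ × ℝ → ℝ, ContDiff ℝ 1 u ∧ ContDiff ℝ 1 v ∧ HasCompactSupport u ∧
      HasCompactSupport v ∧ (∀ p, u p ^ 2 + v p ^ 2 ≤ 1) ∧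
      ∫ q in annulus r R, (fderiv ℝ u q (1, 0) + fderiv ℝ v q (0, 1)) =
        2 * Real.pi * (R + r) := by
  have hR : 0 < R := hr.trans hrR
  have hsq : r ^ 2 < R ^ 2 := pow_lt_pow_left₀ hrR hr.le two_ne_zero
  obtain ⟨δ, hδ, hδ1, hδ2⟩ : ∃ δ : ℝ, 0 < δ ∧ δ ≤ r ^ 2 / 2 ∧ δ ≤ (R ^ 2 - r ^ 2) / 2 :=
    ⟨min (r ^ 2 / 2) ((R ^ 2 - r ^ 2) / 2), lt_min (by positivity) (by linarith),
      min_le_left _ _, min_le_right _ _⟩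
  let b₁ : ContDiffBump (R ^ 2) := ⟨δ / 2, δ, half_pos hδ, half_lt_self hδ⟩
  let b₂ : ContDiffBump (r ^ 2) := ⟨δ / 2, δ, half_pos hδ, half_lt_self hδ⟩
  have hb₁ : ∀ s, δ ≤ |s - R ^ 2| → b₁ s = 0 := fun s hs => b₁.zero_of_le_dist hs
  have hb₂ : ∀ s, δ ≤ |s - r ^ 2| → b₂ s = 0 := fun s hs => b₂.zero_of_le_dist hs
  have hc₁ : b₁ (R ^ 2) = 1 := b₁.one_of_mem_closedBall (Metric.mem_closedBall_self b₁.rIn_pos.le)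
  have hc₂ : b₂ (r ^ 2) = 1 := b₂.one_of_mem_closedBall (Metric.mem_closedBall_self b₂.rIn_pos.le)
  let g : ℝ → ℝ := fun s => (b₁ s - b₂ s) / √s
  have hgR : g (R ^ 2) = 1 / R := by
    simp only [g, hc₁, hb₂ (R ^ 2) (by rw [abs_of_pos (by linarith)]; linarith), sub_zero,
      Real.sqrt_sq hR.le]
  have hgr : g (r ^ 2) = -1 / r := by
    simp only [g, hc₂, hb₁ (r ^ 2) (by rw [abs_of_neg (by linarith)]; linarith), zero_sub,
      Real.sqrt_sq hr.le]
  have hg0 : ∀ s < r ^ 2 / 2, g s = 0 := fun s hs => by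
    simp only [g, hb₁ s (by rw [abs_of_neg (by linarith)]; linarith),
      hb₂ s (by rw [abs_of_neg (by linarith)]; linarith), sub_self, zero_div]
  have hg : ContDiff ℝ 1 g := by
    rw [contDiff_iff_contDiffAt]
    intro s
    rcases lt_or_ge s (r ^ 2 / 2) with hs | hs
    · exact (contDiffAt_const (c := (0 : ℝ))).congr_of_eventuallyEq
        (eventually_of_mem (Iio_mem_nhds hs) hg0)
    · have hs0 : 0 < s := lt_of_lt_of_le (by positivity) hs
      exact (b₁.contDiff.contDiffAt.sub b₂.contDiff.contDiffAt).div
        (Real.contDiffAt_sqrt hs0.ne') (Real.sqrt_pos.2 hs0).ne'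
  have hK : IsCompact (annulus 0 (2 * R)) :=
    (isCompact_Icc.prod isCompact_Icc).of_isClosed_subset (isClosed_annulus _ _)
      (annulus_subset (by positivity))
  have hgK : ∀ q ∉ annulus 0 (2 * R), g (q.1 ^ 2 + q.2 ^ 2) = 0 := by
    intro q hq
    have h1 : (2 * R) ^ 2 < q.1 ^ 2 + q.2 ^ 2 := by
      by_contra hn
      exact hq ⟨by rw [zero_pow two_ne_zero]; positivity, not_lt.1 hn⟩
    simp only [g, hb₁ (q.1 ^ 2 + q.2 ^ 2) (by rw [abs_of_pos (by nlinarith)]; nlinarith),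
      hb₂ (q.1 ^ 2 + q.2 ^ 2) (by rw [abs_of_pos (by nlinarith)]; nlinarith), sub_self, zero_div]
  have hu : ContDiff ℝ 1 fun q : ℝ × ℝ => g (q.1 ^ 2 + q.2 ^ 2) * q.1 := by fun_prop
  have hv : ContDiff ℝ 1 fun q : ℝ × ℝ => g (q.1 ^ 2 + q.2 ^ 2) * q.2 := by fun_prop
  refine ⟨_, _, hu, hv, HasCompactSupport.intro hK fun q hq => by rw [hgK q hq, zero_mul],
    HasCompactSupport.intro hK fun q hq => by rw [hgK q hq, zero_mul], fun q => ?_, ?_⟩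
  · have hs : 0 ≤ q.1 ^ 2 + q.2 ^ 2 := by positivity
    have e : (g (q.1 ^ 2 + q.2 ^ 2) * q.1) ^ 2 + (g (q.1 ^ 2 + q.2 ^ 2) * q.2) ^ 2 =
        g (q.1 ^ 2 + q.2 ^ 2) ^ 2 * (q.1 ^ 2 + q.2 ^ 2) := by ring
    rw [e]
    generalize q.1 ^ 2 + q.2 ^ 2 = s at hs
    rcases hs.eq_or_lt with rfl | hs0
    · simp
    · simp only [g, div_pow, Real.sq_sqrt hs, div_mul_cancel₀ _ hs0.ne']
      rw [sq_le_one_iff_abs_le_one, abs_le]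
      have h1 := b₁.nonneg (x := s)
      have h2 := b₁.le_one (x := s)
      have h3 := b₂.nonneg (x := s)
      have h4 := b₂.le_one (x := s)
      exact ⟨by linarith, by linarith⟩
  · rw [setIntegral_annulus_div hr hrR.le hu hv]
    have e (t θ : ℝ) : (t * Real.cos θ) ^ 2 + (t * Real.sin θ) ^ 2 = t ^ 2 := by
      linear_combination t ^ 2 * Real.cos_sq_add_sin_sq θ
    simp only [e, hgR, hgr]
    have e2 (θ : ℝ) : R * (1 / R * (R * Real.cos θ) * Real.cos θ +
        1 / R * (R * Real.sin θ) * Real.sin θ) - r * (-1 / r * (r * Real.cos θ) * Real.cos θ +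
        -1 / r * (r * Real.sin θ) * Real.sin θ) = R + r := by
      field_simp
      linear_combination (R + r) * Real.cos_sq_add_sin_sq θ
    simp only [e2, intervalIntegral.integral_const, smul_eq_mul]
    ring

lemma setIntegral_div_translate (S : Set (ℝ × ℝ)) (w : ℝ × ℝ) (u v : ℝ × ℝ → ℝ) :
    ∫ q in (fun q => q + w) ⁻¹' S, (fderiv ℝ (fun q => u (q + w)) q (1, 0) +
      fderiv ℝ (fun q => v (q + w)) q (0, 1)) =
    ∫ q in S, (fderiv ℝ u q (1, 0) + fderiv ℝ v q (0, 1)) := by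
  simp only [fderiv_comp_add_right]
  exact (measurePreserving_add_right volume w).setIntegral_preimage_emb
    (measurableEmbedding_addRight w)
    (fun q => fderiv ℝ u q (1, 0) + fderiv ℝ v q (0, 1)) S

lemma hasCompactSupport_comp_add_right {u : ℝ × ℝ → ℝ} (hu : HasCompactSupport u) (w : ℝ × ℝ) :
    HasCompactSupport fun q => u (q + w) :=
  hu.comp_homeomorph (Homeomorph.addRight w)

lemma PlanarPerimeterLE.translate {S : Set (ℝ × ℝ)} {P : ℝ} (hP : PlanarPerimeterLE S P)
    (w : ℝ × ℝ) : PlanarPerimeterLE ((fun q => q + w) ⁻¹' S) P := by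
  intro u v hu hv huc hvc huv
  have h := setIntegral_div_translate S w (fun q => u (q + -w)) (fun q => v (q + -w))
  simp only [add_neg_cancel_right] at h
  rw [h]
  exact hP _ _ (by fun_prop) (by fun_prop) (hasCompactSupport_comp_add_right huc _)
    (hasCompactSupport_comp_add_right hvc _) fun p => huv _

lemma per_translate_annulus {r R : ℝ} (hr : 0 < r) (hrR : r < R) (w : ℝ × ℝ) :
    per (planeEquiv ⁻¹' ((fun q => q + w) ⁻¹' annulus r R)) =
      ENNReal.ofReal (2 * Real.pi * (R + r)) := by
  have e : planeEquiv.symm ⁻¹' (planeEquiv ⁻¹' ((fun q => q + w) ⁻¹' annulus r R)) =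
      (fun q => q + w) ⁻¹' annulus r R := by
    ext q
    simp
  refine le_antisymm ?_ ?_
  · have hpos : 0 ≤ 2 * Real.pi * (R + r) :=
      mul_nonneg Real.two_pi_pos.le (by linarith)
    rw [per_le_ofReal_iff hpos, e]
    exact (planarPerimeterLE_annulus hr hrR.le).translate w
  · obtain ⟨u, v, hu, hv, huc, hvc, huv, h⟩ := exists_field_annulus hr hrR
    rw [← h, ← setIntegral_div_translate _ w, ← e]
    exact ofReal_integral_le_per (by fun_prop) (by fun_prop)
      (hasCompactSupport_comp_add_right huc w) (hasCompactSupport_comp_add_right hvc w)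
      fun p => huv _

lemma volume_translate_annulus {r R : ℝ} (hr : 0 < r) (hrR : r ≤ R) (w : ℝ × ℝ) :
    volume (planeEquiv ⁻¹' ((fun q => q + w) ⁻¹' annulus r R)) =
      ENNReal.ofReal (Real.pi * (R ^ 2 - r ^ 2)) := by
  rw [measurePreserving_planeEquiv.measure_preimage_emb
    planeEquiv.toHomeomorph.measurableEmbedding, measure_preimage_add_right,
    ← volume_real_annulus hr hrR, measureReal_def,
    ENNReal.ofReal_toReal (volume_annulus_ne_top (hr.le.trans hrR))]

/-- The region between the graph of `x² / (1 - x²)` and `+∞`, over `-1 < x < 1`. -/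
def exampleRegion : Set (EuclideanSpace ℝ (Fin 2)) :=
  {p | -1 < p 0 ∧ p 0 < 1 ∧ (p 0) ^ 2 / (1 - (p 0) ^ 2) ≤ p 1}

lemma translate_annulus_subset_exampleRegion {r R : ℝ} (hR : 0 < R) (hR1 : R < 1) :
    planeEquiv ⁻¹' ((fun q => q + (0, -(R + 1 / (1 - R ^ 2)))) ⁻¹' annulus r R) ⊆
      exampleRegion := by
  rintro p ⟨-, hp⟩
  simp only [planeEquiv_apply, Prod.mk_add_mk, add_zero] at hp
  have hx : p 0 ^ 2 ≤ R ^ 2 := le_trans (le_add_of_nonneg_right (sq_nonneg _)) hp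
  have hy : (p 1 + -(R + 1 / (1 - R ^ 2))) ^ 2 ≤ R ^ 2 :=
    le_trans (le_add_of_nonneg_left (sq_nonneg _)) hp
  have h1 := abs_le.1 (abs_le_of_sq_le_sq hx hR.le)
  have h2 := abs_le.1 (abs_le_of_sq_le_sq hy hR.le)
  have hR2 : R ^ 2 < 1 := by nlinarith
  refine ⟨by linarith, by linarith, ?_⟩
  have h3 : p 0 ^ 2 / (1 - p 0 ^ 2) ≤ 1 / (1 - R ^ 2) :=
    div_le_div₀ zero_le_one (by linarith) (by linarith) (by linarith)
  linarith

lemma mem_closure_exampleRegion {p : EuclideanSpace ℝ (Fin 2)} (hp : p ∈ closure exampleRegion) :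
    |p 0| ≤ 1 ∧ p 0 ^ 2 ≤ p 1 * (1 - p 0 ^ 2) := by
  have h1 : IsClosed {p : EuclideanSpace ℝ (Fin 2) | |p 0| ≤ 1} :=
    isClosed_le (by fun_prop) (by fun_prop)
  have h2 : IsClosed {p : EuclideanSpace ℝ (Fin 2) | p 0 ^ 2 ≤ p 1 * (1 - p 0 ^ 2)} :=
    isClosed_le (by fun_prop) (by fun_prop)
  refine closure_minimal (fun q hq => ?_) (h1.inter h2) hp
  obtain ⟨ha, hb, hc⟩ := hq
  exact ⟨abs_le.2 ⟨ha.le, hb.le⟩, (div_le_iff₀ (by nlinarith)).1 hc⟩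

lemma volume_lt_pi_of_subset_closure_exampleRegion {E : Set (EuclideanSpace ℝ (Fin 2))}
    (hE : MeasurableSet E) (hsub : E ⊆ closure exampleRegion)
    (hper : per E = ENNReal.ofReal (2 * Real.pi)) : volume E < ENNReal.ofReal Real.pi := by
  rw [← volume_preimage_planeEquiv_symm]
  refine PlanarPerimeterLE.volume_lt_pi (planeEquiv.symm.continuous.measurable hE)
    ((per_le_ofReal_iff Real.two_pi_pos.le).1 hper.le) fun q hq => ?_
  have h := mem_closure_exampleRegion (hsub hq)
  rwa [planeEquiv_symm_zero, planeEquiv_symm_one] at h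

lemma sSup_volume_exampleRegion :
    sSup {v : ℝ≥0∞ | ∃ E : Set (EuclideanSpace ℝ (Fin 2)), MeasurableSet E ∧
        E ⊆ closure exampleRegion ∧ per E = ENNReal.ofReal (2 * Real.pi) ∧ volume E = v} =
      ENNReal.ofReal Real.pi := by
  refine le_antisymm (sSup_le ?_) ?_
  · rintro _ ⟨E, hE, hsub, hper, rfl⟩
    exact (volume_lt_pi_of_subset_closure_exampleRegion hE hsub hper).le
  · have hlim : Tendsto (fun r : ℝ => ENNReal.ofReal (Real.pi * ((1 - r) ^ 2 - r ^ 2))) (𝓝[>] 0)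
        (𝓝 (ENNReal.ofReal Real.pi)) := by
      have hc : Continuous fun r : ℝ => ENNReal.ofReal (Real.pi * ((1 - r) ^ 2 - r ^ 2)) :=
        ENNReal.continuous_ofReal.comp (by fun_prop)
      have h0 := hc.tendsto 0
      norm_num at h0
      exact h0.mono_left nhdsWithin_le_nhds
    refine le_of_tendsto hlim ?_
    filter_upwards [Ioo_mem_nhdsGT (by norm_num : (0 : ℝ) < 1 / 2)] with r hr
    have hr0 : 0 < r := hr.1
    have hr1 : r < 1 - r := by linarith [hr.2]
    refine le_sSup ⟨_, ?_, (translate_annulus_subset_exampleRegion (hr0.trans hr1)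
      (by linarith)).trans subset_closure, ?_, volume_translate_annulus hr0 hr1.le _⟩
    · exact planeEquiv.continuous.measurable
        ((measurable_add_const _) (measurableSet_annulus _ _))
    · rw [per_translate_annulus hr0 hr1]
      ring_nf

end

/-- In the region `G = {(x,y) : -1 < x < 1, y ≥ x²/(1-x²)}` the problem of maximizing area
among subsets of `cl(G)` of perimeter `2π` has no solution: the supremum of areas is `π`,
but every admissible set has area strictly less than `π`. -/
theorem no_solution_in_example_region :
    sSup {v : ℝ≥0∞ | ∃ E : Set (EuclideanSpace ℝ (Fin 2)), MeasurableSet E ∧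
        E ⊆ closure {p : EuclideanSpace ℝ (Fin 2) |
          -1 < p 0 ∧ p 0 < 1 ∧ (p 0) ^ 2 / (1 - (p 0) ^ 2) ≤ p 1} ∧
        per E = ENNReal.ofReal (2 * Real.pi) ∧ volume E = v} = ENNReal.ofReal Real.pi ∧
    ∀ E : Set (EuclideanSpace ℝ (Fin 2)), MeasurableSet E →
      E ⊆ closure {p : EuclideanSpace ℝ (Fin 2) |
        -1 < p 0 ∧ p 0 < 1 ∧ (p 0) ^ 2 / (1 - (p 0) ^ 2) ≤ p 1} →
      per E = ENNReal.ofReal (2 * Real.pi) → volume E < ENNReal.ofReal Real.pi := by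
  exact ⟨sSup_volume_exampleRegion, fun _ => volume_lt_pi_of_subset_closure_exampleRegion⟩
end

section
/- Let K ⊆ ℝ² be a closed convex set with 𝔯(K) := sup{ r ≥ 0 : some closed disk of radius r is contained in K } = 1, and suppose the closed unit disk B := B₁(0) is contained in K (so B is a maximal disk in K). Let C ⊆ K be a convex set with C ∩ B = ∅ such that the line H := {(x,y) : y = −1} is a common support line of B and C, i.e. C ⊆ {(x,y) : y ≥ −1} and cl(C) ∩ H ≠ ∅. Then C is contained in the stripe S := {(x,y) ∈ ℝ² : |y| ≤ 1}. -/
open MeasureTheory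
open scoped ENNReal

open Filter Topology in
/-- If the closed unit ball is a largest ball in the closed convex set `K`, then every closed
half-space of directions contains the unit normal of a common supporting hyperplane of `K` and the
unit ball. -/
theorem exists_unit_normal_of_maximal_ball {E : Type*} [NormedAddCommGroup E]
    [InnerProductSpace ℝ E] [FiniteDimensional ℝ E] {K : Set E} (hKclosed : IsClosed K)
    (hKconv : Convex ℝ K) (hB : Metric.closedBall (0 : E) 1 ⊆ K)
    (hmax : ∀ (x : E) (r : ℝ), 0 ≤ r → Metric.closedBall x r ⊆ K → r ≤ 1) (v : E) :
    ∃ u : E, ‖u‖ = 1 ∧ 0 ≤ inner ℝ u v ∧ ∀ k ∈ K, inner ℝ u k ≤ 1 := by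
  have approx : ∀ ε : ℝ, 0 < ε →
      ∃ u : E, ‖u‖ = 1 ∧ ∀ k ∈ K, inner ℝ u k ≤ 1 + ε * inner ℝ u v + ε ^ 2 := by
    intro ε hε
    have hnot : ¬ Metric.closedBall (ε • v) (1 + ε ^ 2) ⊆ K := fun h => by
      have := hmax _ _ (by positivity) h
      nlinarith [pow_pos hε 2]
    obtain ⟨x, hx, hxK⟩ := Set.not_subset.1 hnot
    obtain ⟨f, s, hfs, hsx⟩ := geometric_hahn_banach_closed_point hKconv hKclosed hxK
    set w : E := (InnerProductSpace.toDual ℝ E).symm f with hw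
    have hwf : ∀ y, inner ℝ w y = f y := fun y => by
      rw [hw, InnerProductSpace.toDual_symm_apply]
    have hw0 : w ≠ 0 := by
      intro h0
      have h1 := hfs 0 (hB (by simp))
      have h2 := hwf x
      rw [h0, inner_zero_left] at h2
      rw [map_zero] at h1
      linarith
    have hwpos : 0 < ‖w‖ := norm_pos_iff.2 hw0
    have hu1 : ‖‖w‖⁻¹ • w‖ = 1 := by
      rw [norm_smul, norm_inv, norm_norm, inv_mul_cancel₀ hwpos.ne']
    refine ⟨‖w‖⁻¹ • w, hu1, fun k hk => ?_⟩
    have hkx : inner ℝ (‖w‖⁻¹ • w) k ≤ inner ℝ (‖w‖⁻¹ • w) x := by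
      rw [real_inner_smul_left, real_inner_smul_left, hwf, hwf]
      exact mul_le_mul_of_nonneg_left ((hfs k hk).trans hsx).le (inv_nonneg.2 hwpos.le)
    have hdist : inner ℝ (‖w‖⁻¹ • w) (x - ε • v) ≤ 1 + ε ^ 2 := by
      refine (real_inner_le_norm _ _).trans ?_
      rw [hu1, one_mul, ← dist_eq_norm]
      exact Metric.mem_closedBall.1 hx
    rw [inner_sub_right, real_inner_smul_right] at hdist
    linarith
  choose! g hg1 hgK using approx
  have hε : ∀ n : ℕ, (0 : ℝ) < 1 / ((n : ℝ) + 1) := fun n => Nat.one_div_pos_of_nat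
  obtain ⟨u, hu, φ, hφ, hlim⟩ := (isCompact_sphere (0 : E) 1).tendsto_subseq
    (x := fun n : ℕ => g (1 / ((n : ℝ) + 1)))
    (fun n => by simpa using hg1 _ (hε n))
  have hεlim : Tendsto (fun n => 1 / ((φ n : ℝ) + 1)) atTop (𝓝 (0 : ℝ)) :=
    tendsto_one_div_add_atTop_nhds_zero_nat.comp hφ.tendsto_atTop
  have hinner : ∀ y : E, Tendsto (fun n => inner ℝ (g (1 / ((φ n : ℝ) + 1))) y) atTop
      (𝓝 (inner ℝ u y)) := fun y => hlim.inner tendsto_const_nhds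
  refine ⟨u, by simpa using hu, ?_, fun k hk => ?_⟩
  · have h := (hinner v).add hεlim
    rw [add_zero] at h
    refine ge_of_tendsto' h fun n => ?_
    have hpos := hε (φ n)
    have hself := hgK _ hpos _ (hB (mem_closedBall_zero_iff.2 (hg1 _ hpos).le))
    rw [real_inner_self_eq_norm_sq, hg1 _ hpos] at hself
    by_contra! hneg
    nlinarith [mul_neg_of_pos_of_neg hpos hneg]
  · have h := (tendsto_const_nhds (x := (1 : ℝ))).add (hεlim.mul (hinner v)) |>.add (hεlim.pow 2)
    have h' := le_of_tendsto_of_tendsto' (hinner k) h fun n => hgK _ (hε (φ n)) k hk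
    simpa using h'

/-- A convex set disjoint from the unit disk, lying above `y = -1` and having a point above
`y = 1`, does not have the bottom point of the disk in its closure. -/
theorem fst_ne_zero_of_mem_closure {C : Set (EuclideanSpace ℝ (Fin 2))} (hCconv : Convex ℝ C)
    (hdisj : C ∩ Metric.closedBall (0 : EuclideanSpace ℝ (Fin 2)) 1 = ∅)
    {p q : EuclideanSpace ℝ (Fin 2)} (hp : p ∈ C) (hp1 : 1 < p 1) (hq : q ∈ closure C)
    (hq1 : q 1 = -1) : q 0 ≠ 0 := by
  intro hq0
  set M : ℝ := p 0 ^ 2 + (p 1 + 1) ^ 2 with hM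
  have hMpos : 1 < M := by nlinarith [sq_nonneg (p 0)]
  set t : ℝ := 1 / M with ht
  have htpos : 0 < t := by positivity
  have htM : t * M = 1 := by rw [ht]; field_simp
  have ht1 : t < 1 := by nlinarith
  have hopen : IsOpen {z : EuclideanSpace ℝ (Fin 2) |
      ((1 - t) * z 0 + t * p 0) ^ 2 + ((1 - t) * z 1 + t * p 1) ^ 2 < 1} :=
    isOpen_lt (by fun_prop) continuous_const
  obtain ⟨z, hz, hzC⟩ := mem_closure_iff.1 hq _ hopen (by
    change ((1 - t) * q 0 + t * p 0) ^ 2 + ((1 - t) * q 1 + t * p 1) ^ 2 < 1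
    rw [hq0, hq1]
    have : ((1 - t) * 0 + t * p 0) ^ 2 + ((1 - t) * -1 + t * p 1) ^ 2
        = 1 - 2 * t * (p 1 + 1) + t * (t * M) := by rw [hM]; ring
    rw [this, htM]
    nlinarith)
  have hw : (1 - t) • z + t • p ∈ C := hCconv hzC hp (by linarith) htpos.le (by ring)
  refine Set.eq_empty_iff_forall_notMem.1 hdisj _ ⟨hw, ?_⟩
  rw [mem_closedBall_zero_iff, EuclideanSpace.norm_eq, Real.sqrt_le_one]
  simpa [Fin.sum_univ_two] using (show _ < (1 : ℝ) from hz).le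

/-- If `q` on the line `y = -1` lies in the closure of `C` to one side of the unit disk and `C` has
a point above `y = 1`, then no line tangent to the disk on that side supports `C`. -/
theorem mul_fst_nonpos_of_unit_normal {C : Set (EuclideanSpace ℝ (Fin 2))} (hCconv : Convex ℝ C)
    (hdisj : C ∩ Metric.closedBall (0 : EuclideanSpace ℝ (Fin 2)) 1 = ∅)
    (hsupp : C ⊆ {p : EuclideanSpace ℝ (Fin 2) | -1 ≤ p 1})
    {p q : EuclideanSpace ℝ (Fin 2)} (hp : p ∈ C) (hp1 : 1 < p 1) (hq : q ∈ closure C)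
    (hq1 : q 1 = -1) {x y : ℝ} (hxy : x ^ 2 + y ^ 2 = 1)
    (hC : ∀ k ∈ C, x * k 0 + y * k 1 ≤ 1) : x * q 0 ≤ 0 := by
  by_contra! hpos
  have hqle : x * q 0 + y * q 1 ≤ 1 := by
    have hcl : IsClosed {k : EuclideanSpace ℝ (Fin 2) | x * k 0 + y * k 1 ≤ 1} :=
      isClosed_le (by fun_prop) continuous_const
    exact closure_minimal hC hcl hq
  have hy : 0 < 1 + y := by rw [hq1] at hqle; linarith
  have hx2 : 0 < x ^ 2 := by
    have : x ≠ 0 := by rintro rfl; simp at hpos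
    positivity
  -- `d k` is a positive multiple of the signed distance to the line through `(0,-1)` and `(x,y)`
  set d : EuclideanSpace ℝ (Fin 2) → ℝ := fun k => x * ((1 + y) * k 0 - x * (k 1 + 1)) with hd
  have hdq : 0 < d q := by
    simp only [hd, hq1]
    nlinarith [mul_pos hy hpos]
  have hdp : d p < 0 := by
    have h := mul_le_mul_of_nonneg_left (hC p hp) hy.le
    have hy1 : y ≤ 1 := by nlinarith
    have h2 : 0 < (1 + y) * (p 1 - y) := mul_pos hy (by linarith)
    have h3 : x ^ 2 * (p 1 + 1) = (1 - y ^ 2) * (p 1 + 1) := by rw [← hxy]; ring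
    simp only [hd]
    nlinarith
  have hopen : IsOpen {k | 0 < d k} := isOpen_lt continuous_const (by simp only [hd]; fun_prop)
  obtain ⟨z, hz, hzC⟩ := mem_closure_iff.1 hq _ hopen hdq
  have hz : 0 < d z := hz
  have hden : 0 < d z - d p := by linarith
  set t : ℝ := d z / (d z - d p) with ht
  have htpos : 0 ≤ t := by positivity
  have ht1 : t ≤ 1 := by rw [ht, div_le_one hden]; linarith
  have hw : (1 - t) • z + t • p ∈ C := hCconv hzC hp (by linarith) htpos (by ring)
  have hdw : d ((1 - t) • z + t • p) = 0 := by
    have h1 : d ((1 - t) • z + t • p) = (1 - t) * d z + t * d p := by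
      simp [hd]; ring
    have h2 : t * (d z - d p) = d z := by rw [ht]; field_simp
    rw [h1]; linarith
  generalize (1 - t) • z + t • p = w at hw hdw
  have hw1 : -1 ≤ w 1 := hsupp hw
  have hwle := hC w hw
  have hx : x ≠ 0 := by rintro rfl; simp at hx2
  have hline : (1 + y) * w 0 = x * (w 1 + 1) := by
    have := (mul_eq_zero.1 hdw).resolve_left hx
    linarith
  obtain ⟨s, hs⟩ : ∃ s, s * (1 + y) = w 1 + 1 := ⟨(w 1 + 1) / (1 + y), by field_simp⟩
  have hw0 : w 0 = s * x := by
    apply mul_left_cancel₀ hy.ne'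
    rw [hline, ← hs]; ring
  have hw1' : w 1 = s * (1 + y) - 1 := by linarith
  have hs0 : 0 ≤ s := by
    by_contra! h
    nlinarith [mul_neg_of_neg_of_pos h hy]
  have hs1 : s ≤ 1 := by
    rw [hw0, hw1'] at hwle
    have : x * (s * x) + y * (s * (1 + y) - 1) = s * (1 + y) - y := by
      linear_combination s * hxy
    rw [this] at hwle
    by_contra! h
    nlinarith [mul_lt_mul_of_pos_right h hy]
  refine Set.eq_empty_iff_forall_notMem.1 hdisj w ⟨hw, ?_⟩
  rw [mem_closedBall_zero_iff, EuclideanSpace.norm_eq, Real.sqrt_le_one]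
  simp only [Fin.sum_univ_two, Real.norm_eq_abs, sq_abs]
  rw [hw0, hw1']
  have : (s * x) ^ 2 + (s * (1 + y) - 1) ^ 2 = 1 - 2 * (1 + y) * (s * (1 - s)) := by
    linear_combination s ^ 2 * hxy
  rw [this]
  have := mul_nonneg hy.le (mul_nonneg hs0 (sub_nonneg.2 hs1))
  linarith

open Filter Topology in
/-- A point `(a, b)` with `1 < b` stays outside the unit disk when cut by a line of small slope. -/
theorem exists_pos_slope {a b : ℝ} (hb : 1 < b) :
    ∃ δ : ℝ, 0 < δ ∧ 0 < b - δ * a ∧ 1 + δ ^ 2 < (b - δ * a) ^ 2 := by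
  have h1 : ∀ᶠ δ in 𝓝 (0 : ℝ), 0 < b - δ * a :=
    (by fun_prop : Continuous fun δ : ℝ => b - δ * a).continuousAt.eventually
      (lt_mem_nhds (by simp; linarith))
  have h2 : ∀ᶠ δ in 𝓝 (0 : ℝ), 0 < (b - δ * a) ^ 2 - (1 + δ ^ 2) :=
    (by fun_prop : Continuous fun δ : ℝ => (b - δ * a) ^ 2 - (1 + δ ^ 2)).continuousAt.eventually
      (lt_mem_nhds (by nlinarith))
  have h3 : ∀ᶠ δ in 𝓝[>] (0 : ℝ), 0 < δ := eventually_mem_nhdsWithin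
  obtain ⟨δ, hδ, ha, hc⟩ :=
    (h3.and ((h1.filter_mono nhdsWithin_le_nhds).and (h2.filter_mono nhdsWithin_le_nhds))).exists
  exact ⟨δ, hδ, ha, by linarith⟩

/-- Let `K ⊆ ℝ²` be closed and convex with inradius `𝔯(K) = 1`, containing the closed unit
disk `B = B₁(0)` (a maximal disk in `K`). If `C ⊆ K` is convex, disjoint from `B`, and the
line `{y = -1}` is a common support line of `B` and `C` (i.e. `C` lies in `{y ≥ -1}` and
`cl(C)` touches `{y = -1}`), then `C` is contained in the stripe `{|y| ≤ 1}`. -/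
theorem convex_subset_in_stripe (K : Set (EuclideanSpace ℝ (Fin 2)))
    (hKclosed : IsClosed K) (hKconv : Convex ℝ K)
    (hinr : sSup {r : ℝ | 0 ≤ r ∧ ∃ x : EuclideanSpace ℝ (Fin 2),
      Metric.closedBall x r ⊆ K} = 1)
    (hB : Metric.closedBall (0 : EuclideanSpace ℝ (Fin 2)) 1 ⊆ K)
    (C : Set (EuclideanSpace ℝ (Fin 2))) (hCsub : C ⊆ K) (hCconv : Convex ℝ C)
    (hdisj : C ∩ Metric.closedBall (0 : EuclideanSpace ℝ (Fin 2)) 1 = ∅)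
    (hsupp : C ⊆ {p : EuclideanSpace ℝ (Fin 2) | -1 ≤ p 1})
    (htouch : (closure C ∩ {p : EuclideanSpace ℝ (Fin 2) | p 1 = -1}).Nonempty) :
    C ⊆ {p : EuclideanSpace ℝ (Fin 2) | |p 1| ≤ 1} := by
  have hmax : ∀ (x : EuclideanSpace ℝ (Fin 2)) (r : ℝ), 0 ≤ r →
      Metric.closedBall x r ⊆ K → r ≤ 1 := by
    intro x r hr hx
    rw [← hinr]
    refine le_csSup ?_ ⟨hr, x, hx⟩
    by_contra hbdd
    rw [Real.sSup_of_not_bddAbove hbdd] at hinr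
    exact zero_ne_one hinr
  intro p hp
  have hp_ge : -1 ≤ p 1 := hsupp hp
  refine abs_le.2 ⟨hp_ge, ?_⟩
  by_contra! hp1
  obtain ⟨q, hq, hq1⟩ := htouch
  have hq1 : q 1 = -1 := hq1
  have hq0 := fst_ne_zero_of_mem_closure hCconv hdisj hp hp1 hq hq1
  obtain ⟨σ, hσ, hσq⟩ : ∃ σ : ℝ, σ ^ 2 = 1 ∧ 0 < σ * q 0 := by
    rcases hq0.lt_or_gt with h | h
    · exact ⟨-1, by norm_num, by linarith⟩
    · exact ⟨1, by norm_num, by linarith⟩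
  obtain ⟨δ, hδ, hδ1, hδ2⟩ := exists_pos_slope (a := |σ * p 0|) hp1
  obtain ⟨u, hu, huv, huK⟩ :=
    exists_unit_normal_of_maximal_ball hKclosed hKconv hB hmax !₂[σ, δ]
  have hnorm : u 0 ^ 2 + u 1 ^ 2 = 1 := by
    have h := EuclideanSpace.real_norm_sq_eq u
    rw [hu, Fin.sum_univ_two] at h
    linarith
  have hinner : ∀ k : EuclideanSpace ℝ (Fin 2), inner ℝ u k = u 0 * k 0 + u 1 * k 1 := fun k => by
    simp [PiLp.inner_apply, Fin.sum_univ_two, mul_comm]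
  have huC : ∀ k ∈ C, u 0 * k 0 + u 1 * k 1 ≤ 1 := fun k hk => by
    rw [← hinner]; exact huK k (hCsub hk)
  have hside := mul_fst_nonpos_of_unit_normal hCconv hdisj hsupp hp hp1 hq hq1 hnorm huC
  have hdir : 0 ≤ u 0 * σ + u 1 * δ := by simpa [hinner] using huv
  have hx : u 0 * σ ≤ 0 := by
    by_contra! h
    have h1 := mul_pos h hσq
    have h2 : u 0 * σ * (σ * q 0) = u 0 * q 0 := by linear_combination (u 0 * q 0) * hσ
    linarith
  set x := u 0 * σ with hxdef
  have hxy : x ^ 2 + u 1 ^ 2 = 1 := by rw [hxdef]; linear_combination hnorm + u 0 ^ 2 * hσ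
  have hpx : x * (σ * p 0) + u 1 * p 1 ≤ 1 := by
    have h2 : x * (σ * p 0) = u 0 * p 0 := by rw [hxdef]; linear_combination (u 0 * p 0) * hσ
    rw [h2]; exact huC p hp
  have hy : 0 < u 1 := by
    by_contra! h
    have h1 : δ * u 1 ≤ 0 := mul_nonpos_of_nonneg_of_nonpos hδ.le h
    have hx0 : x = 0 := by linarith
    have hy0 : u 1 = 0 := by
      rcases mul_eq_zero.1 (show δ * u 1 = 0 by linarith) with h' | h'
      · exact absurd h' hδ.ne'
      · exact h'
    rw [hx0, hy0] at hxy
    norm_num at hxy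
  have hxa : -(u 1 * δ * |σ * p 0|) ≤ x * (σ * p 0) := by
    have h1 : -x * (σ * p 0) ≤ -x * |σ * p 0| :=
      mul_le_mul_of_nonneg_left (le_abs_self _) (by linarith)
    have h2 : -x * |σ * p 0| ≤ u 1 * δ * |σ * p 0| :=
      mul_le_mul_of_nonneg_right (by linarith) (abs_nonneg _)
    linarith
  have hle : u 1 * (p 1 - δ * |σ * p 0|) ≤ 1 := by linarith
  have hsq : (u 1 * (p 1 - δ * |σ * p 0|)) ^ 2 ≤ 1 := pow_le_one₀ (by positivity) hle
  have hx2 : x ^ 2 ≤ (u 1 * δ) ^ 2 := sq_le_sq' (by linarith) (by nlinarith)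
  have hlt := mul_lt_mul_of_pos_left hδ2 (pow_pos hy 2)
  linarith [mul_pow (u 1) (p 1 - δ * |σ * p 0|) 2, mul_pow (u 1) δ 2]
end
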